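/- Let $K$ be an algebraically closed field and $A$ a finitely generated $K$-algebra that is a domain of GK dimension less than $3$. If $D$ is a division subalgebra of $Q(A)$ containing $K$ such that $Q(A)$ is infinite-dimensional as a left $D$-vector space, then $D$ is commutative. -/

import Mathlib

open Filter

/-- The GK growth exponent `limsup_n log(dim V^n)/log n` (in `EReal`) of a
finite-dimensional subspace `V` of a `K`-algebra. -/
noncomputable def gkWrt (K : Type*) {Q : Type*} [Field K] [Ring Q] [Algebra K Q]
    (V : Submodule K Q) : EReal :=
  Filter.limsup
    (fun n : ℕ => ((Real.log (Module.finrank K ↥(V ^ n)) / Real.log n : ℝ) : EReal)) atTop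


section part1
open MvPolynomial

theorem height_origin (K : Type*) [Field K] (V : ℕ) :
    (V : ℕ∞) ≤ (RingHom.ker (aeval (fun _ : Fin V => (0:K)) : MvPolynomial (Fin V) K →ₐ[K] K)).height := by
  classical
  set φ : ℕ → (MvPolynomial (Fin V) K →ₐ[K] MvPolynomial (Fin V) K) := fun j =>
    aeval (fun i : Fin V => if (i:ℕ) < j then 0 else X i) with hφ
  have key : ∀ j : ℕ, j ≤ V → (j : ℕ∞) ≤ (RingHom.ker (φ j)).height := by
    intro j
    induction j with
    | zero => intro _; simp
    | succ j ih =>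
      intro hj
      have h1 := ih (by omega)
      haveI : (RingHom.ker (φ j)).IsPrime := RingHom.ker_isPrime _
      haveI : (RingHom.ker (φ (j+1))).IsPrime := RingHom.ker_isPrime _
      have hlt : RingHom.ker (φ j) < RingHom.ker (φ (j+1)) := by
        refine lt_of_le_of_ne ?_ ?_
        · intro p hp
          have hcomp : (φ (j+1)).comp (φ j) = φ (j+1) := by
            apply MvPolynomial.algHom_ext
            intro i
            simp only [hφ, AlgHom.comp_apply, aeval_X]
            split_ifs with h1 h2 h2
            · simp
            · omega
            · simp; omega
            · simp; omega
          rw [RingHom.mem_ker] at hp ⊢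
          rw [← hcomp, AlgHom.comp_apply, hp, map_zero]
        · intro h
          have : (X (⟨j, by omega⟩ : Fin V) : MvPolynomial (Fin V) K) ∈ RingHom.ker (φ (j+1)) := by
            rw [RingHom.mem_ker]; simp [hφ]
          rw [← h, RingHom.mem_ker] at this
          simp [hφ] at this
      have := Ideal.height_add_one_le_of_lt_of_isPrime hlt
      push_cast
      exact le_trans (by gcongr) this
  refine (key V le_rfl).trans ?_
  apply Ideal.height_mono
  intro p hp
  rw [RingHom.mem_ker] at hp ⊢
  have : (aeval (fun _ : Fin V => (0:K)) : MvPolynomial (Fin V) K →ₐ[K] K) =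
     (aeval (fun _ : Fin V => (0:K)) : MvPolynomial (Fin V) K →ₐ[K] K).comp (φ V) := by
    apply MvPolynomial.algHom_ext
    intro i
    simp [hφ]
  rw [this, AlgHom.comp_apply, hp, map_zero]

theorem exists_common_zero_fin (K : Type*) [Field K] [IsAlgClosed K] {V : ℕ} {ι : Type*} [Fintype ι]
    (q : ι → MvPolynomial (Fin V) K) (d : ℕ) (hd : d ≠ 0) (hq : ∀ i, (q i).IsHomogeneous d)
    (hcard : Fintype.card ι < V) : ∃ z : Fin V → K, z ≠ 0 ∧ ∀ i, eval z (q i) = 0 := by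
  classical
  by_contra hcon
  push Not at hcon
  set I : Ideal (MvPolynomial (Fin V) K) := Ideal.span (Set.range q) with hI
  set m : Ideal (MvPolynomial (Fin V) K) := RingHom.ker (aeval (fun _ : Fin V => (0:K)) : MvPolynomial (Fin V) K →ₐ[K] K) with hm
  haveI : m.IsPrime := RingHom.ker_isPrime _
  have hIm : I ≤ m := by
    rw [hI, Ideal.span_le]
    rintro _ ⟨i, rfl⟩
    rw [SetLike.mem_coe, hm, RingHom.mem_ker]
    have := hq i
    have h0 : (fun _ : Fin V => (0:K)) = 0 := rfl
    rw [h0, aeval_zero]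
    simp only [Algebra.algebraMap_self, RingHom.id_apply, constantCoeff_eq]
    exact this.coeff_eq_zero (by simpa using hd.symm)
  have hmrad : m ≤ I.radical := by
    rw [← vanishingIdeal_zeroLocus_eq_radical (k := K) (K := K)]
    intro p hp
    rw [mem_vanishingIdeal_iff]
    intro x hx
    rw [mem_zeroLocus_iff] at hx
    have hx0 : x = 0 := by
      by_contra hne
      obtain ⟨i, hi⟩ := hcon x hne
      exact hi (by simpa [aeval_eq_eval] using hx (q i) (Ideal.subset_span ⟨i, rfl⟩))
    subst hx0
    exact hp
  have hmin : m ∈ I.minimalPrimes := by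
    refine ⟨⟨inferInstance, hIm⟩, ?_⟩
    rintro P ⟨hP, hIP⟩ _
    exact hmrad.trans (hP.isRadical.radical_le_iff.mpr hIP)
  have h1 : m.height ≤ (Finset.univ.image q).card := by
    apply Ideal.height_le_card_of_mem_minimalPrimes_span_finset
    simpa using hmin
  have h2 : (V : ℕ∞) ≤ ((Finset.univ.image q).card : ℕ∞) := (height_origin K V).trans h1
  have h3 : V ≤ (Finset.univ.image q).card := by exact_mod_cast h2
  have h4 := Finset.card_image_le (s := Finset.univ) (f := q)
  rw [Finset.card_univ] at h4
  omega

theorem exists_common_zero (K : Type*) [Field K] [IsAlgClosed K] {σ ι : Type*} [Fintype σ] [Fintype ι]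
    (q : ι → MvPolynomial σ K) (d : ℕ) (hd : d ≠ 0) (hq : ∀ i, (q i).IsHomogeneous d)
    (hcard : Fintype.card ι < Fintype.card σ) : ∃ z : σ → K, z ≠ 0 ∧ ∀ i, eval z (q i) = 0 := by
  classical
  let e := Fintype.equivFin σ
  obtain ⟨z, hz, h⟩ := exists_common_zero_fin K (fun i => rename e (q i)) d hd
    (fun i => (hq i).rename_isHomogeneous) hcard
  refine ⟨z ∘ e, ?_, fun i => ?_⟩
  · intro h0
    apply hz
    funext i
    have := congrFun h0 (e.symm i)
    simpa using this
  · have := h i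
    rwa [eval_rename] at this

end part1

section part2
open MvPolynomial

/-- all coefficients homogeneous of degree `e` -/
def CoeffHom {S : Type*} {K : Type*} [Field K] (f : Polynomial (MvPolynomial S K)) (e : ℕ) : Prop :=
  ∀ j, (f.coeff j).IsHomogeneous e

theorem CoeffHom.mul {S K : Type*} [Field K] {f g : Polynomial (MvPolynomial S K)} {a b : ℕ}
    (hf : CoeffHom f a) (hg : CoeffHom g b) : CoeffHom (f * g) (a + b) := by
  intro j
  rw [Polynomial.coeff_mul]
  exact IsHomogeneous.sum _ _ _ fun i _ => (hf _).mul (hg _)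

theorem CoeffHom.one {S K : Type*} [Field K] : CoeffHom (1 : Polynomial (MvPolynomial S K)) 0 := by
  intro j
  rw [Polynomial.coeff_one]
  split_ifs
  · exact isHomogeneous_one _ _
  · exact isHomogeneous_zero _ _ _

theorem CoeffHom.pow {S K : Type*} [Field K] {f : Polynomial (MvPolynomial S K)} {a : ℕ}
    (hf : CoeffHom f a) (n : ℕ) : CoeffHom (f ^ n) (n * a) := by
  induction n with
  | zero => simpa using CoeffHom.one
  | succ n ih => rw [pow_succ, Nat.succ_mul]; exact ih.mul hf

theorem CoeffHom.prod {S K τ : Type*} [Field K] (s : Finset τ) (f : τ → Polynomial (MvPolynomial S K)) (a : τ → ℕ)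
    (hf : ∀ i ∈ s, CoeffHom (f i) (a i)) : CoeffHom (∏ i ∈ s, f i) (∑ i ∈ s, a i) := by
  classical
  induction s using Finset.induction_on with
  | empty => simpa using CoeffHom.one
  | insert i s hi ih =>
    rw [Finset.prod_insert hi, Finset.sum_insert hi]
    exact (hf i (by simp)).mul (ih fun j hj => hf j (by simp [hj]))

theorem CoeffHom.sum {S K τ : Type*} [Field K] (s : Finset τ) (f : τ → Polynomial (MvPolynomial S K)) (a : ℕ)
    (hf : ∀ i ∈ s, CoeffHom (f i) a) : CoeffHom (∑ i ∈ s, f i) a := by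
  intro j
  rw [Polynomial.finset_sum_coeff]
  exact IsHomogeneous.sum _ _ _ fun i hi => hf i hi j

theorem tsen_lang_poly (K : Type*) [Field K] [IsAlgClosed K] {σ κ : Type*} [Fintype σ] [Fintype κ]
    (p : κ → MvPolynomial σ (Polynomial K)) (d : ℕ) (hd : d ≠ 0) (hp : ∀ k, (p k).IsHomogeneous d)
    (hcard : Fintype.card κ * d < Fintype.card σ) :
    ∃ y : σ → Polynomial K, y ≠ 0 ∧ ∀ k, eval y (p k) = 0 := by
  classical
  obtain ⟨c, hc⟩ : ∃ c : ℕ, ∀ k, ∀ m ∈ (p k).support, ((p k).coeff m).natDegree ≤ c := by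
    refine ⟨∑ k, ∑ m ∈ (p k).support, ((p k).coeff m).natDegree, fun k m hm => ?_⟩
    refine le_trans ?_ (Finset.single_le_sum (f := fun k => ∑ m ∈ (p k).support, ((p k).coeff m).natDegree) (by simp) (Finset.mem_univ k))
    exact Finset.single_le_sum (f := fun m => ((p k).coeff m).natDegree) (by simp) hm
  set n := Fintype.card κ * (c + 1) with hn
  let S := σ × Fin (n + 1)
  let Y : σ → Polynomial (MvPolynomial S K) := fun i => ∑ k : Fin (n+1), Polynomial.monomial (k:ℕ) (X (i, k))
  let cm : Polynomial K →+* Polynomial (MvPolynomial S K) := Polynomial.mapRingHom C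
  let G : κ → Polynomial (MvPolynomial S K) := fun k => eval₂ cm Y (p k)
  have hY1 : ∀ i, CoeffHom (Y i) 1 := by
    intro i
    apply CoeffHom.sum
    intro k _ j
    rw [Polynomial.coeff_monomial]
    split_ifs
    · exact isHomogeneous_X _ _
    · exact isHomogeneous_zero _ _ _
  have hYd : ∀ i, (Y i).natDegree ≤ n := by
    intro i
    apply Polynomial.natDegree_sum_le_of_forall_le
    intro k _
    exact (Polynomial.natDegree_monomial_le _).trans (by omega)
  have hG : ∀ k, G k = ∑ m ∈ (p k).support, cm ((p k).coeff m) * ∏ i, Y i ^ m i := by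
    intro k; exact eval₂_eq' _ _ _
  have hdeg : ∀ k, ∀ m ∈ (p k).support, ∑ i, m i = d := by
    intro k m hm
    have := hp k (mem_support_iff.mp hm)
    rw [Finsupp.weight_apply, Finsupp.sum_fintype] at this
    · simpa using this
    · simp
  have hGh : ∀ k, CoeffHom (G k) d := by
    intro k
    rw [hG]
    apply CoeffHom.sum
    intro m hm
    have h1 : CoeffHom (cm ((p k).coeff m)) 0 := by
      intro j
      simp only [cm, Polynomial.coe_mapRingHom, Polynomial.coeff_map]
      exact isHomogeneous_C _ _
    have h2 : CoeffHom (∏ i, Y i ^ m i) (∑ i, m i) := by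
      apply CoeffHom.prod
      intro i _
      simpa using (hY1 i).pow (m i)
    rw [hdeg k m hm] at h2
    simpa using h1.mul h2
  have hGd : ∀ k, (G k).natDegree ≤ c + d * n := by
    intro k
    rw [hG]
    apply Polynomial.natDegree_sum_le_of_forall_le
    intro m hm
    refine Polynomial.natDegree_mul_le.trans (add_le_add ?_ ?_)
    · exact (Polynomial.natDegree_map_le).trans (hc k m hm)
    · refine (Polynomial.natDegree_prod_le _ _).trans ?_
      rw [← hdeg k m hm, Finset.sum_mul]
      apply Finset.sum_le_sum
      intro i _
      exact Polynomial.natDegree_pow_le.trans (Nat.mul_le_mul_left _ (hYd i))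
  obtain ⟨z, hz, h⟩ := exists_common_zero K (σ := S) (ι := κ × Fin (c + d * n + 1))
    (fun q => (G q.1).coeff q.2) d hd (fun q => hGh _ _) (by
      simp only [Fintype.card_prod, Fintype.card_fin, S]
      have : Fintype.card κ * (c + d * n + 1) = Fintype.card κ * d * n + n := by rw [hn]; ring
      rw [this]
      nlinarith [Nat.zero_le n])
  let ev : Polynomial (MvPolynomial S K) →+* Polynomial K := Polynomial.mapRingHom (eval z)
  have hevG : ∀ k, ev (G k) = eval (fun i => ev (Y i)) (p k) := by
    intro k
    change ev (eval₂ cm Y (p k)) = _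
    rw [MvPolynomial.hom_eval₂]
    have : ev.comp cm = RingHom.id _ := by
      apply Polynomial.ringHom_ext
      · intro a; simp [ev, cm]
      · simp [ev, cm]
    rw [this]
    rfl
  refine ⟨fun i => ev (Y i), ?_, ?_⟩
  · intro h0
    apply hz
    funext ⟨i, k⟩
    have h1 := congrArg (fun f => Polynomial.coeff f (k:ℕ)) (congrFun h0 i)
    simp only [Pi.zero_apply, Polynomial.coeff_zero, ev, Y, Polynomial.coe_mapRingHom, Polynomial.coeff_map,
      Polynomial.finset_sum_coeff, Polynomial.coeff_monomial] at h1
    rw [Finset.sum_eq_single k] at h1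
    · simpa using h1
    · intro b _ hb
      rw [if_neg]
      intro h; exact hb (Fin.ext h)
    · simp
  · intro k
    rw [← hevG]
    ext j
    simp only [ev, Polynomial.coe_mapRingHom, Polynomial.coeff_map, Polynomial.coeff_zero]
    by_cases hj : j < c + d * n + 1
    · exact h (k, ⟨j, hj⟩)
    · rw [Polynomial.coeff_eq_zero_of_natDegree_lt, map_zero]
      have := hGd k
      omega

theorem tsen_lang (K H : Type*) [Field K] [IsAlgClosed K] [Field H] [Algebra (Polynomial K) H]
    [IsFractionRing (Polynomial K) H] {σ κ : Type*} [Fintype σ] [Fintype κ]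
    (p : κ → MvPolynomial σ H) (d : ℕ) (hd : d ≠ 0) (hp : ∀ k, (p k).IsHomogeneous d)
    (hcard : Fintype.card κ * d < Fintype.card σ) :
    ∃ y : σ → H, y ≠ 0 ∧ ∀ k, eval y (p k) = 0 := by
  classical
  obtain ⟨g, hg⟩ := IsLocalization.exist_integer_multiples (nonZeroDivisors (Polynomial K))
    (Finset.univ.sigma (fun k => (p k).support)) (fun q => (p q.1).coeff q.2)
  have hg' : ∀ k m, ∃ a : Polynomial K, algebraMap _ H a = algebraMap (Polynomial K) H (g : Polynomial K) * (p k).coeff m ∧ ((p k).coeff m = 0 → a = 0) := by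
    intro k m
    by_cases hm : m ∈ (p k).support
    · obtain ⟨a, ha⟩ := hg ⟨k, m⟩ (by simpa using hm)
      refine ⟨a, by rw [ha, Algebra.smul_def], ?_⟩
      intro h; exact absurd h (mem_support_iff.mp hm)
    · exact ⟨0, by rw [notMem_support_iff.mp hm]; simp, fun _ => rfl⟩
  choose a ha ha0 using hg'
  have hinj : Function.Injective (algebraMap (Polynomial K) H) := IsFractionRing.injective _ _
  have hgne : algebraMap (Polynomial K) H (g : Polynomial K) ≠ 0 := by
    rw [Ne, map_eq_zero_iff _ hinj]; exact nonZeroDivisors.coe_ne_zero g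
  let P : κ → MvPolynomial σ (Polynomial K) := fun k => ∑ m ∈ (p k).support, monomial m (a k m)
  have hP : ∀ k, map (algebraMap (Polynomial K) H) (P k) = C (algebraMap (Polynomial K) H (g : Polynomial K)) * p k := by
    intro k
    conv_rhs => rw [(p k).as_sum]
    simp only [P, map_sum, map_monomial, Finset.mul_sum, C_mul_monomial, ha]
  obtain ⟨y, hy, h⟩ := tsen_lang_poly K P d hd (fun k => by
    apply IsHomogeneous.sum
    intro m hm
    apply isHomogeneous_monomial
    have := hp k (mem_support_iff.mp hm)
    rw [← this]; simp [Finsupp.degree_eq_weight_one]; rfl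
    ) hcard
  refine ⟨fun i => algebraMap _ H (y i), ?_, fun k => ?_⟩
  · intro h0
    apply hy
    funext i
    exact hinj (by simpa using congrFun h0 i)
  · have h1 : eval (fun i => algebraMap _ H (y i)) (map (algebraMap (Polynomial K) H) (P k)) = 0 := by
      rw [eval_map]
      have := congrArg (algebraMap (Polynomial K) H) (h k)
      rw [map_zero] at this
      rw [← this]
      rw [← MvPolynomial.eval₂_id, MvPolynomial.hom_eval₂]
      rfl
    rw [hP, map_mul, eval_C] at h1
    exact (mul_eq_zero.mp h1).resolve_left hgne

end part2

section part3
open TensorProduct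

section lemA
variable {F L Δ : Type*} [Field F] [Field L] [DivisionRing Δ] [Algebra F Δ] [Algebra F L] [Module L Δ]
  [IsScalarTower F L Δ] [IsScalarTower L Δ Δ]

/-- right multiplication, left `L`-linear -/
def rmul (L : Type*) {Δ : Type*} [Field L] [DivisionRing Δ] [Module L Δ] [IsScalarTower L Δ Δ] (a : Δ) : Δ →ₗ[L] Δ where
  toFun v := v * a
  map_add' u v := add_mul _ _ _
  map_smul' l v := smul_mul_assoc _ _ _

@[simp] theorem rmul_apply {L Δ : Type*} [Field L] [DivisionRing Δ] [Module L Δ] [IsScalarTower L Δ Δ] (a v : Δ) :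
    rmul L a v = v * a := rfl

theorem artin_indep (hcent : ∀ z : Δ, (∀ v, z * v = v * z) → ∃ f, z = algebraMap F Δ f)
    {ι : Type*} (b : ι → Δ) (hb : LinearIndependent F b) :
    ∀ (n : ℕ) (s : Finset ι) (c : ι → Δ), s.card ≤ n → (∀ v, ∑ i ∈ s, c i * v * b i = 0) → ∀ i ∈ s, c i = 0 := by
  classical
  intro n
  induction n with
  | zero => 
    intro s c hs
    have : s = ∅ := by simpa using hs
    subst this; simp
  | succ n ih =>
    intro s c hs h i0 hi0
    by_contra hne
    set c' : ι → Δ := fun i => (c i0)⁻¹ * c i with hc'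
    have h' : ∀ v, ∑ i ∈ s, c' i * v * b i = 0 := by
      intro v
      have := congrArg (fun w => (c i0)⁻¹ * w) (h v)
      simpa [Finset.mul_sum, hc', mul_assoc] using this
    have hc0 : c' i0 = 1 := by simp [hc', hne]
    have hcc : ∀ z, ∀ i ∈ s, z * c' i = c' i * z := by
      intro z i hi
      by_cases hii : i = i0
      · rw [hii, hc0]; simp
      have := ih (s.erase i0) (fun i => z * c' i - c' i * z) (by
        rw [Finset.card_erase_of_mem hi0]; omega) (by
        intro v
        have h1 : ∑ i ∈ s, (z * c' i - c' i * z) * v * b i = 0 := by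
          have e1 := congrArg (fun w => z * w) (h' v)
          have e2 := h' (z * v)
          simp only [Finset.mul_sum, mul_zero] at e1
          simp only [sub_mul, Finset.sum_sub_distrib]
          rw [sub_eq_zero]
          simp only [mul_assoc] at e1 e2 ⊢
          rw [e1, e2]
        rw [← Finset.add_sum_erase _ _ hi0] at h1
        simpa [hc0] using h1) i (Finset.mem_erase.mpr ⟨hii, hi⟩)
      exact sub_eq_zero.mp this
    have hf : ∀ i ∈ s, ∃ f, c' i = algebraMap F Δ f := fun i hi => hcent _ (fun v => (hcc v i hi).symm)
    choose! f hf using hf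
    have h1 := h' 1
    have h2 : ∑ i ∈ s, f i • b i = 0 := by
      rw [← h1]
      apply Finset.sum_congr rfl
      intro i hi
      rw [hf i hi, Algebra.smul_def, mul_one]
    have h3 := linearIndependent_iff'.mp hb s f h2 i0 hi0
    have h4 := hf i0 hi0
    rw [hc0, h3, map_zero] at h4
    exact one_ne_zero h4

theorem rmul_indep (hcent : ∀ z : Δ, (∀ v, z * v = v * z) → ∃ f, z = algebraMap F Δ f)
    {ι : Type*} (b : ι → Δ) (hb : LinearIndependent F b) :
    LinearIndependent L (fun i => rmul L (b i)) := by
  rw [linearIndependent_iff']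
  intro s g hg i hi
  have := artin_indep hcent b hb s.card s (fun i => g i • (1:Δ)) le_rfl (by
    intro v
    have := LinearMap.congr_fun hg v
    simpa [smul_mul_assoc] using this) i hi
  exact (smul_eq_zero.mp this).resolve_right one_ne_zero

attribute [local instance] TensorProduct.Algebra.module

theorem rmul_span [Module.Finite L Δ] (hmax : ∀ c : Δ, (∀ l : L, c * (l • 1) = (l • 1) * c) → ∃ l : L, c = l • 1)
    {ι : Type*} (b : Module.Basis ι F Δ) :
    ⊤ ≤ Submodule.span L (Set.range (fun i => rmul L (b i))) := by
  classical
  haveI : SMulCommClass L Δᵐᵒᵖ Δ := ⟨fun l a v => by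
    simp [MulOpposite.smul_eq_mul_unop, smul_mul_assoc]⟩
  haveI : IsScalarTower F Δᵐᵒᵖ Δ := ⟨fun f a v => by
    simp [MulOpposite.smul_eq_mul_unop]⟩
  let R := L ⊗[F] Δᵐᵒᵖ
  have hsm : ∀ (l : L) (a : Δ) (v : Δ), ((l ⊗ₜ[F] MulOpposite.op a : R) • v) = l • (v * a) := by
    intro l a v
    rw [TensorProduct.Algebra.smul_def]; rfl
  haveI : IsSimpleModule R Δ := by
    rw [isSimpleModule_iff_toSpanSingleton_surjective]
    refine ⟨inferInstance, fun v hv w => ⟨(1 : L) ⊗ₜ[F] MulOpposite.op (v⁻¹ * w), ?_⟩⟩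
    rw [LinearMap.toSpanSingleton_apply, hsm, one_smul, mul_inv_cancel_left₀ hv]
  have hend : ∀ g : Module.End R Δ, ∃ l : L, ∀ v, g v = l • v := by
    intro g
    have hg1 : ∀ v, g v = g 1 * v := by
      intro v
      have := g.map_smul ((1 : L) ⊗ₜ[F] MulOpposite.op v) 1
      rw [hsm, hsm] at this
      simpa using this
    have hg2 : ∀ (l : L) v, g (l • v) = l • g v := by
      intro l v
      have := g.map_smul (l ⊗ₜ[F] MulOpposite.op 1) v
      rw [hsm, hsm] at this
      simpa using this
    obtain ⟨l, hl⟩ := hmax (g 1) (fun l => by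
      rw [← hg1, hg2, smul_mul_assoc, one_mul])
    exact ⟨l, fun v => by rw [hg1, hl, smul_mul_assoc, one_mul]⟩
  intro T _
  let T' : Module.End (Module.End R Δ) Δ :=
    { toFun := T
      map_add' := T.map_add
      map_smul' := fun g v => by
        obtain ⟨l, hl⟩ := hend g
        simp only [Module.End.smul_def, hl, map_smul, RingHom.id_apply] }
  let v := Module.finBasis L Δ
  obtain ⟨r, hr⟩ := jacobson_density (R := R) T' (Finset.univ.image v)
  have key : ∀ r : R, ∃ T₁ ∈ Submodule.span L (Set.range (fun i => rmul L (b i))), ∀ u, T₁ u = r • u := by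
    intro r
    induction r using TensorProduct.induction_on with
    | zero => exact ⟨0, zero_mem _, fun u => (zero_smul R u).symm⟩
    | add x y hx hy =>
      obtain ⟨S, hS, h1⟩ := hx
      obtain ⟨S', hS', h2⟩ := hy
      exact ⟨S + S', add_mem hS hS', fun u => by rw [LinearMap.add_apply, h1, h2, add_smul]⟩
    | tmul l a =>
      refine ⟨l • rmul L a.unop, Submodule.smul_mem _ _ ?_, fun u => ?_⟩
      · have : rmul L a.unop = (b.repr a.unop).sum (fun i f => algebraMap F L f • rmul L (b i)) := by
          ext u
          conv_lhs => rw [← b.linearCombination_repr a.unop]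
          simp only [rmul_apply, Finsupp.linearCombination_apply, Finsupp.sum, Finset.mul_sum, LinearMap.sum_apply,
            LinearMap.smul_apply, algebraMap_smul, mul_smul_comm]
        rw [this]
        exact Submodule.sum_mem _ fun i _ => Submodule.smul_mem _ _ (Submodule.subset_span ⟨i, rfl⟩)
      · have := hsm l a.unop u
        rw [MulOpposite.op_unop] at this
        rw [this]; rfl
  obtain ⟨T₁, hT₁, h1⟩ := key r
  have : T = T₁ := by
    apply v.ext
    intro i
    rw [h1]
    exact hr (v i) (by simp)
  rw [this]; exact hT₁
end lemA

end part3

section part4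

theorem exists_max_subfield {Δ : Type*} [DivisionRing Δ] (T : Set Δ) (hT : ∀ a ∈ T, ∀ b ∈ T, a * b = b * a) :
    ∃ M : Subfield Δ, T ⊆ M ∧ ∀ c, c ∈ M ↔ ∀ l ∈ M, c * l = l * c := by
  obtain ⟨S, hTS, hS⟩ := zorn_subset_nonempty {S : Set Δ | ∀ a ∈ S, ∀ b ∈ S, a * b = b * a} (by
    intro c hc hch hne
    refine ⟨⋃₀ c, ?_, fun s hs => Set.subset_sUnion_of_mem hs⟩
    rintro a ⟨s, hs, ha⟩ b ⟨t, ht, hb⟩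
    rcases hch.total hs ht with h | h
    · exact hc ht a (h ha) b hb
    · exact hc hs a ha b (h hb)) T hT
  have key : ∀ c, c ∈ S ↔ ∀ l ∈ S, c * l = l * c := by
    intro c
    refine ⟨fun hc l hl => hS.prop c hc l hl, fun h => ?_⟩
    have : (insert c S) ⊆ S := hS.le_of_ge (by
      intro a ha b hb
      rcases ha with rfl | ha <;> rcases hb with rfl | hb
      · rfl
      · exact h b hb
      · exact (h a ha).symm
      · exact hS.prop a ha b hb) (Set.subset_insert c S)
    exact this (Set.mem_insert c S)
  refine ⟨{ carrier := S
            mul_mem' := ?_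
            one_mem' := (key 1).2 (by simp)
            add_mem' := ?_
            zero_mem' := (key 0).2 (by simp)
            neg_mem' := ?_
            inv_mem' := ?_ }, hTS, key⟩
  · intro a b ha hb
    refine (key _).2 fun l hl => ?_
    rw [mul_assoc, (key b).1 hb l hl, ← mul_assoc, (key a).1 ha l hl, mul_assoc]
  · intro a b ha hb
    refine (key _).2 fun l hl => ?_
    rw [add_mul, mul_add, (key b).1 hb l hl, (key a).1 ha l hl]
  · intro a ha
    refine (key _).2 fun l hl => ?_
    rw [neg_mul, mul_neg, (key a).1 ha l hl]
  · intro a ha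
    refine (key _).2 fun l hl => ?_
    have : Commute a l := (key a).1 ha l hl
    exact this.inv_left₀

section lemA2
variable {F L Δ : Type*} [Field F] [Field L] [DivisionRing Δ] [Algebra F Δ] [Algebra F L] [Module L Δ]
  [IsScalarTower F L Δ] [IsScalarTower L Δ Δ]

/-- the `L`-basis of `End_L Δ` -/
noncomputable def rbasis [Module.Finite L Δ] (hcent : ∀ z : Δ, (∀ v, z * v = v * z) → ∃ f, z = algebraMap F Δ f)
    (hmax : ∀ c : Δ, (∀ l : L, c * (l • 1) = (l • 1) * c) → ∃ l : L, c = l • 1)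
    {ι : Type*} (b : Module.Basis ι F Δ) : Module.Basis ι L (Δ →ₗ[L] Δ) :=
  Module.Basis.mk (rmul_indep (L := L) hcent b b.linearIndependent) (rmul_span hmax b)

theorem lemA_finite [Module.Finite L Δ] (hcent : ∀ z : Δ, (∀ v, z * v = v * z) → ∃ f, z = algebraMap F Δ f)
    (hmax : ∀ c : Δ, (∀ l : L, c * (l • 1) = (l • 1) * c) → ∃ l : L, c = l • 1) :
    Module.Finite F Δ ∧ Module.finrank F Δ = Module.finrank L Δ * Module.finrank L Δ ∧
     Module.finrank F L = Module.finrank L Δ := by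
  let b := Module.Basis.ofVectorSpace F Δ
  let B := rbasis (L := L) hcent hmax b
  have hfin : Module.Finite F Δ := by
    have := Module.Finite.finite_basis B
    exact Module.Finite.of_basis b
  have h2 : Module.finrank F Δ = Module.finrank L Δ * Module.finrank L Δ := by
    rw [← Module.finrank_linearMap L L Δ Δ, Module.finrank_eq_nat_card_basis b, Module.finrank_eq_nat_card_basis B]
  refine ⟨hfin, h2, ?_⟩
  have h3 := Module.finrank_mul_finrank F L Δ
  rw [h2] at h3
  exact Nat.eq_of_mul_eq_mul_right Module.finrank_pos h3

theorem det_rmul_pow [Module.Finite L Δ] (hcent : ∀ z : Δ, (∀ v, z * v = v * z) → ∃ f, z = algebraMap F Δ f)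
    (hmax : ∀ c : Δ, (∀ l : L, c * (l • 1) = (l • 1) * c) → ∃ l : L, c = l • 1) (a : Δ) :
    (LinearMap.det (rmul L a)) ^ (Module.finrank L Δ) = algebraMap F L (LinearMap.det (rmul F a)) := by
  classical
  haveI := (lemA_finite (L := L) hcent hmax).1
  let b := Module.finBasis F Δ
  let B := rbasis (L := L) hcent hmax b
  have hB : ∀ i, B i = rmul L (b i) := fun i => by simp [B, rbasis]
  let P : (Δ →ₗ[L] Δ) →ₗ[L] (Δ →ₗ[L] Δ) := LinearMap.llcomp L Δ Δ Δ (rmul L a)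
  have hP : ∀ X, P X = (rmul L a).comp X := fun X => rfl
  have h1 : LinearMap.det P = algebraMap F L (LinearMap.det (rmul F a)) := by
    rw [← LinearMap.det_toMatrix B, ← LinearMap.det_toMatrix b, RingHom.map_det]
    congr 1
    ext i j
    rw [LinearMap.toMatrix_apply, RingHom.mapMatrix_apply, Matrix.map_apply, LinearMap.toMatrix_apply]
    have : P (B j) = ∑ i, algebraMap F L (b.repr (b j * a) i) • B i := by
      rw [hP, hB]
      ext u
      have h := b.sum_repr (b j * a)
      simp only [LinearMap.comp_apply, rmul_apply, LinearMap.sum_apply, LinearMap.smul_apply, algebraMap_smul, hB]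
      rw [mul_assoc]
      conv_lhs => rw [← h]
      rw [Finset.mul_sum]
      exact Finset.sum_congr rfl fun i _ => mul_smul_comm _ _ _
    rw [this, B.repr_sum_self]
    rfl
  rw [← h1]
  let v := Module.finBasis L Δ
  let e : (Δ →ₗ[L] Δ) ≃ₗ[L] (Fin (Module.finrank L Δ) → Δ) := (v.constr L).symm
  have h2 := LinearMap.det_pi (fun _ : Fin (Module.finrank L Δ) => rmul L a)
  rw [← LinearMap.det_conj P e, ]
  simp only [Finset.prod_const, Finset.card_univ, Fintype.card_fin] at h2
  rw [← h2]
  congr 1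
  refine LinearMap.ext fun w => funext fun i => ?_
  change _ = (rmul L a) ((v.constr L w) (v i))
  rw [Module.Basis.constr_basis]
  rfl

theorem det_rmul_norm {M : Type*} [Field M] [Algebra F M] [Module M Δ] [IsScalarTower F M Δ] [Module.Finite F Δ]
    (a : Δ) (m : M) (hm : ∀ v : Δ, m • v = v * a) :
    LinearMap.det (rmul F a) = (Algebra.norm F m) ^ (Module.finrank M Δ) := by
  let f : Δ →ₗ[M] Δ := m • LinearMap.id
  have h1 : rmul F a = f.restrictScalars F := by
    ext v
    simp [f, hm]
  rw [h1, LinearMap.det_restrictScalars, LinearMap.det_smul]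
  simp

theorem algClosed_mem {K R : Type*} [Field K] [IsAlgClosed K] [Ring R] [IsDomain R] [Algebra K R] (z : R) (hz : IsIntegral K z) :
    ∃ k, algebraMap K R k = z :=
  minpoly.mem_range_of_degree_eq_one K z (IsAlgClosed.degree_eq_one_of_irreducible K (minpoly.irreducible hz))

theorem det_mem_F {K : Type*} [Field K] [IsAlgClosed K] [Algebra K F] [Algebra K L] [IsScalarTower K F L]
    [Module.Finite L Δ] (hcent : ∀ z : Δ, (∀ v, z * v = v * z) → ∃ f, z = algebraMap F Δ f)
    (hmax : ∀ c : Δ, (∀ l : L, c * (l • 1) = (l • 1) * c) → ∃ l : L, c = l • 1) (a : Δ) :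
    ∃ f, LinearMap.det (rmul L a) = algebraMap F L f := by
  obtain ⟨hfin, hd2, hFL⟩ := lemA_finite (L := L) hcent hmax
  obtain ⟨M, haM, hM⟩ := exists_max_subfield ({a} : Set Δ) (by simp)
  have hFM : ∀ f : F, algebraMap F Δ f ∈ M := fun f => (hM _).2 fun l _ => Algebra.commutes f l
  letI iM : Field M := { (inferInstance : DivisionRing M) with mul_comm := fun x y => Subtype.ext ((hM x).1 x.2 y y.2) }
  letI iA : Algebra F M := ((algebraMap F Δ).codRestrict M hFM).toAlgebra
  have hnorm : ∃ f : F, LinearMap.det (rmul F a) = f ^ (Module.finrank L Δ) := by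
    have hleft : Module.finrank F M * Module.finrank F M = Module.finrank F Δ := by
      haveI : IsScalarTower F M Δ := ⟨fun f m v => by
        change (algebraMap F Δ f * m.1) * v = f • (m.1 * v)
        rw [Algebra.smul_def, mul_assoc]⟩
      haveI : Module.Finite M Δ := Module.Finite.of_restrictScalars_finite F M Δ
      haveI : IsScalarTower M Δ Δ := ⟨fun m v w => mul_assoc m.1 v w⟩
      obtain ⟨_, h1, h2⟩ := lemA_finite (F := F) (L := M) (Δ := Δ) hcent (fun c hc => by
        refine ⟨⟨c, (hM c).2 fun l hl => ?_⟩, ?_⟩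
        · have := hc ⟨l, hl⟩
          change c * (l * 1) = (l * 1) * c at this
          simpa using this
        · change c = c * 1
          simp)
      rw [h1, h2]
    have hms : ∀ (m m' : M) (v : Δ), v * (m.1 * m'.1) = (v * m'.1) * m.1 := by
      intro m m' v
      rw [mul_assoc, (hM m).1 m.2 m' m'.2]
    have htow : ∀ (f : F) (m : M) (v : Δ), v * (algebraMap F Δ f * m.1) = f • (v * m.1) := by
      intro f m v
      rw [Algebra.smul_def, ← mul_assoc, ← mul_assoc, Algebra.commutes]
    letI iR : Module M Δ :=
      { smul := fun m v => v * m.1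
        one_smul := fun v => mul_one v
        mul_smul := fun m m' v => hms m m' v
        smul_zero := fun m => zero_mul _
        smul_add := fun m u v => add_mul _ _ _
        add_smul := fun m m' v => mul_add _ _ _
        zero_smul := fun v => mul_zero v }
    haveI : @IsScalarTower F M Δ _ iR.toDistribMulAction.toMulAction.toSMul Algebra.toSMul :=
      @IsScalarTower.mk F M Δ _ iR.toDistribMulAction.toMulAction.toSMul Algebra.toSMul htow
    haveI : @Module.Finite M Δ _ _ iR :=
      @Module.Finite.of_restrictScalars_finite F M Δ _ _ _ _ iR _ _ _
    haveI : Module.Finite F M :=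
      @Module.Finite.left F M Δ _ _ _ _ iR _ _ _ _ _ _
    have h3 := @Module.finrank_mul_finrank F M Δ _ _ _ _ iR _ _ _ _ _ _
    have hr : @Module.finrank M Δ _ _ iR = Module.finrank L Δ := by
      have hpos : 0 < Module.finrank F M := Module.finrank_pos
      have e1 : Module.finrank F M = Module.finrank L Δ := by
        rw [hd2] at hleft
        exact Nat.mul_self_inj.mp hleft
      rw [← e1]
      rw [← hleft] at h3
      exact Nat.eq_of_mul_eq_mul_left hpos h3
    have h5 := det_rmul_norm (F := F) (M := M) (Δ := Δ) a ⟨a, haM rfl⟩ (fun v => rfl)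
    rw [hr] at h5
    exact ⟨_, h5⟩
  obtain ⟨f, hf⟩ := hnorm
  have hpow := det_rmul_pow (L := L) hcent hmax a
  have hdpos : Module.finrank L Δ ≠ 0 := Module.finrank_pos.ne'
  rw [hf, map_pow] at hpow
  by_cases hf0 : algebraMap F L f = 0
  · rw [hf0, zero_pow hdpos] at hpow
    exact ⟨0, by rw [map_zero]; exact pow_eq_zero_iff hdpos |>.mp hpow⟩
  have hz : (LinearMap.det (rmul L a) / algebraMap F L f) ^ (Module.finrank L Δ) = 1 := by
    rw [div_pow, hpow, div_self (pow_ne_zero _ hf0)]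
  obtain ⟨k, hk⟩ := algClosed_mem (K := K) (LinearMap.det (rmul L a) / algebraMap F L f)
    (IsIntegral.of_pow (Nat.pos_of_ne_zero hdpos) (by rw [hz]; exact isIntegral_one))
  refine ⟨algebraMap K F k * f, ?_⟩
  rw [map_mul, ← IsScalarTower.algebraMap_apply, hk, div_mul_cancel₀ _ hf0]
end lemA2

end part4

section part5
section tsenabs
open MvPolynomial
variable {F L Δ : Type*} [Field F] [Field L] [DivisionRing Δ] [Algebra F Δ] [Algebra F L] [Module L Δ]
  [IsScalarTower F L Δ] [IsScalarTower L Δ Δ]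

theorem rmul_sum_smul {H : Type*} [Field H] [Algebra H L] [Module H Δ] [IsScalarTower H L Δ]
    {ι : Type*} [Fintype ι] (w : ι → Δ) (y : ι → H) [SMulCommClass H Δ Δ] :
    rmul L (∑ i, y i • w i) = ∑ i, algebraMap H L (y i) • rmul L (w i) := by
  ext u
  simp only [rmul_apply, Finset.mul_sum, LinearMap.sum_apply,
            LinearMap.smul_apply, algebraMap_smul, mul_smul_comm]

theorem tsen_abs {K H : Type*} [Field K] [IsAlgClosed K] [Field H] [Algebra (Polynomial K) H] [IsFractionRing (Polynomial K) H]
    [Algebra K F] [Algebra K L] [IsScalarTower K F L]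
    [Algebra H F] [Algebra H L] [Algebra H Δ] [IsScalarTower H F L] [IsScalarTower H F Δ] [IsScalarTower H L Δ]
    [Module.Finite H F]
    [Module.Finite L Δ] (hcent : ∀ z : Δ, (∀ v, z * v = v * z) → ∃ f, z = algebraMap F Δ f)
    (hmax : ∀ c : Δ, (∀ l : L, c * (l • 1) = (l • 1) * c) → ∃ l : L, c = l • 1) :
    Module.finrank L Δ = 1 := by
  classical
  obtain ⟨hfin, hd2, hFL⟩ := lemA_finite (L := L) hcent hmax
  haveI : Module.Finite H Δ := Module.Finite.trans F Δ
  set d := Module.finrank L Δ with hd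
  have hdpos : 0 < d := Module.finrank_pos
  have hspos : 0 < Module.finrank H F := Module.finrank_pos
  by_contra hne
  have hn : Module.finrank H F * (d * d) = Module.finrank H Δ := by
    rw [← hd2]; exact Module.finrank_mul_finrank H F Δ
  let w := Module.finBasis H Δ
  let v : Module.Basis (Fin d) L Δ := Module.finBasis L Δ
  let M : Matrix (Fin d) (Fin d) (MvPolynomial (Fin (Module.finrank H Δ)) L) :=
    fun j k => ∑ i, X i * C (LinearMap.toMatrix v v (rmul L (w i)) j k)
  let P := M.det
  have hPh : P.IsHomogeneous d := by
    simp only [P, Matrix.det_apply]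
    refine IsHomogeneous.sum _ _ _ fun σ _ => ?_
    have : (∏ i, M (σ i) i).IsHomogeneous (∑ i : Fin d, 1) := by
      refine IsHomogeneous.prod _ _ _ fun i _ => ?_
      refine IsHomogeneous.sum _ _ _ fun k _ => ?_
      have := (isHomogeneous_X L k).mul (isHomogeneous_C (Fin (Module.finrank H Δ)) (LinearMap.toMatrix v v (rmul L (w k)) (σ i) i))
      simpa using this
    simp only [Finset.sum_const, Finset.card_univ, Fintype.card_fin, smul_eq_mul, mul_one] at this
    rcases Int.units_eq_one_or (Equiv.Perm.sign σ) with h | h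
    · rw [h, one_smul]; exact this
    · rw [h, Units.neg_smul, one_smul]; exact this.neg
  have hPe : ∀ y : Fin (Module.finrank H Δ) → H, eval (fun i => algebraMap H L (y i)) P = LinearMap.det (rmul L (∑ i, y i • w i)) := by
    intro y
    rw [← LinearMap.det_toMatrix v, RingHom.map_det, rmul_sum_smul (L := L) (fun i => w i) y]
    congr 1
    ext j k
    rw [RingHom.mapMatrix_apply, Matrix.map_apply, map_sum (LinearMap.toMatrix v v), Matrix.sum_apply]
    simp only [M, map_sum, map_mul, eval_X, eval_C, map_smul, Matrix.smul_apply, smul_eq_mul]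
  obtain ⟨g, hg⟩ := LinearMap.exists_leftInverse_of_injective ((Algebra.linearMap F L).restrictScalars H) (by
    rw [LinearMap.ker_eq_bot]; exact (algebraMap F L).injective)
  let bF := Module.finBasis H F
  let φ : Fin (Module.finrank H F) → (L →ₗ[H] H) := fun k => (bF.coord k).comp g
  let Qp : Fin (Module.finrank H F) → MvPolynomial (Fin (Module.finrank H Δ)) H :=
    fun k => ∑ m ∈ P.support, monomial m (φ k (coeff m P))
  have hQh : ∀ k, (Qp k).IsHomogeneous d := by
    intro k
    refine IsHomogeneous.sum _ _ _ fun m hm => ?_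
    refine isHomogeneous_monomial _ ?_
    have := hPh (mem_support_iff.mp hm)
    rw [Finsupp.degree_eq_weight_one]; exact this
  have hQe : ∀ k y, eval y (Qp k) = φ k (eval (fun i => algebraMap H L (y i)) P) := by
    intro k y
    rw [eval_eq _ P]
    simp only [Qp, map_sum, eval_monomial]
    refine Finset.sum_congr rfl fun m _ => ?_
    have : coeff m P * ∏ i ∈ m.support, algebraMap H L (y i) ^ m i = (∏ i ∈ m.support, y i ^ m i) • coeff m P := by
      rw [Algebra.smul_def, map_prod, mul_comm]
      simp
    rw [this, map_smul, smul_eq_mul, mul_comm]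
    rfl
  obtain ⟨y, hy0, hy⟩ := tsen_lang K H Qp d hdpos.ne' hQh (by
    simp only [Fintype.card_fin]
    rw [← hn]
    have : 1 < d := by omega
    nlinarith [mul_pos hspos hdpos])
  obtain ⟨f, hf⟩ := det_mem_F (K := K) (L := L) hcent hmax (∑ i, y i • w i)
  have hgf : g (algebraMap F L f) = f := LinearMap.congr_fun hg f
  have hf0 : f = 0 := by
    apply bF.repr.injective
    ext k
    have := hy k
    rw [hQe, hPe, hf] at this
    simpa [φ, hgf] using this
  rw [hf0, map_zero] at hf
  have ha : ∑ i, y i • w i = 0 := by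
    by_contra hne'
    have h1 : (rmul L (∑ i, y i • w i)).comp (rmul L (∑ i, y i • w i)⁻¹) = LinearMap.id := by
      ext u
      simp [mul_assoc, hne']
    have := congrArg LinearMap.det h1
    rw [LinearMap.det_comp, hf] at this
    simp at this
  apply hy0
  funext i
  have := Fintype.linearIndependent_iff.mp w.linearIndependent y ha i
  simpa using this
end tsenabs

end part5

section part6
section ca
open scoped IntermediateField.algebraAdjoinAdjoin
theorem isAlg_of_subalg {K H L : Type*} [Field K] [Field H] [Field L] [Algebra K H] [Algebra H L] [Algebra K L]
    [IsScalarTower K H L] (R : Subalgebra K L) (hle : R ≤ (IsScalarTower.toAlgHom K H L).range) (x : L)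
    (hx : IsAlgebraic R x) : IsAlgebraic H x := by
  let f := IsScalarTower.toAlgHom K H L
  let e := AlgEquiv.ofInjectiveField f
  let φ : R →ₐ[K] H := e.symm.toAlgHom.comp (Subalgebra.inclusion hle)
  have hφ : ∀ r : R, algebraMap H L (φ r) = r := by
    intro r
    have : e (φ r) = Subalgebra.inclusion hle r := by
      simp [φ]
    exact congrArg Subtype.val this
  letI : Algebra R H := φ.toRingHom.toAlgebra
  haveI : IsScalarTower R H L := IsScalarTower.of_algebraMap_eq fun r => (hφ r).symm
  refine hx.extendScalars (R := R) (S := H) ?_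
  intro a b hab
  have := congrArg (algebraMap H L) hab
  change algebraMap H L (φ a) = algebraMap H L (φ b) at this
  rw [hφ, hφ] at this
  exact Subtype.ext this

theorem finite_over_H {K H L : Type*} [Field K] [Field H] [Field L] [Algebra K H] [Algebra H L] [Algebra K L]
    [IsScalarTower K H L] (x t : L) (hfin : Module.Finite (IntermediateField.adjoin K {x}) L)
    (ht : Transcendental K t) (htH : ∃ h, algebraMap H L h = t) : Module.Finite H L := by
  haveI : Algebra.IsAlgebraic (Algebra.adjoin K {x}) L := by
    rw [IsFractionRing.comap_isAlgebraic_iff (A := Algebra.adjoin K {x}) (K := IntermediateField.adjoin K {x}) (C := L)]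
    infer_instance
  have htr : Algebra.trdeg K L ≤ 1 := by
    have := Algebra.IsAlgebraic.trdeg_le_cardinalMk K ({x} : Set L)
    simpa using this
  have hind : AlgebraicIndependent K (fun _ : Unit => t) := by
    rw [algebraicIndependent_unique_type_iff]
    exact ht
  have hbas : IsTranscendenceBasis K (fun _ : Unit => t) :=
    hind.isTranscendenceBasis_of_lift_trdeg_le (htr.trans_lt Cardinal.one_lt_aleph0) (by simpa using htr)
  have halg := hbas.isAlgebraic
  have hx : IsAlgebraic H x := by
    refine isAlg_of_subalg (K := K) _ ?_ x (halg.isAlgebraic x)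
    rw [Algebra.adjoin_le_iff]
    rintro _ ⟨_, rfl⟩
    exact htH
  haveI : FiniteDimensional H (IntermediateField.adjoin H {x}) :=
    IntermediateField.adjoin.finiteDimensional hx.isIntegral
  have hle : IntermediateField.adjoin K {x} ≤ (IntermediateField.adjoin H {x}).restrictScalars K := by
    rw [IntermediateField.adjoin_le_iff]
    rintro _ rfl
    exact IntermediateField.mem_adjoin_simple_self H _
  letI : SMul (IntermediateField.adjoin K {x}) (IntermediateField.adjoin H {x}) :=
    ⟨fun a b => (⟨a.1, hle a.2⟩ : IntermediateField.adjoin H {x}) * b⟩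
  haveI : IsScalarTower (IntermediateField.adjoin K {x}) (IntermediateField.adjoin H {x}) L :=
    ⟨fun a b c => mul_assoc a.1 b.1 c⟩
  haveI : Module.Finite (IntermediateField.adjoin H {x}) L :=
    Module.Finite.of_restrictScalars_finite (IntermediateField.adjoin K {x}) _ L
  exact Module.Finite.trans (IntermediateField.adjoin H {x}) L
end ca

end part6

section part7

theorem tsen {K Δ : Type*} [Field K] [IsAlgClosed K] [DivisionRing Δ] [Algebra K Δ] (x : Δ)
    (E : Subfield Δ) (hE : E = Subfield.closure (Set.range (algebraMap K Δ) ∪ {x})) (hfin : Module.Finite E Δ) :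
    ∀ a b : Δ, a * b = b * a := by
  obtain ⟨L, hTL, hL⟩ := exists_max_subfield (Set.range (algebraMap K Δ) ∪ {x}) (by
    rintro a (⟨k, rfl⟩ | rfl) b hb
    · exact Algebra.commutes k b
    · rcases hb with ⟨k, rfl⟩ | rfl
      · exact (Algebra.commutes k a).symm
      · rfl)
  have hEL : E ≤ L := by rw [hE, Subfield.closure_le]; exact hTL
  letI iL : Field L := { (inferInstance : DivisionRing L) with mul_comm := fun x y => Subtype.ext ((hL x).1 x.2 y y.2) }
  let F := Subring.center Δ
  letI iF : Field F := Subring.instField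
  have hFL : ∀ f : F, F.subtype f ∈ L := fun f => (hL _).2 fun l _ => (Subring.mem_center_iff.mp f.2 l).symm
  have hKF : ∀ k : K, algebraMap K Δ k ∈ F := fun k => Subring.mem_center_iff.mpr fun v => (Algebra.commutes k v).symm
  letI aFΔ : Algebra F Δ := F.subtype.toAlgebra' (fun f v => (Subring.mem_center_iff.mp f.2 v).symm)
  letI aFL : Algebra F L := (F.subtype.codRestrict L hFL).toAlgebra
  letI aKF : Algebra K F := ((algebraMap K Δ).codRestrict F hKF).toAlgebra
  letI aKL : Algebra K L := ((algebraMap F L).comp (algebraMap K F)).toAlgebra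
  haveI : IsScalarTower K F L := IsScalarTower.of_algebraMap_eq fun _ => rfl
  haveI : IsScalarTower K F Δ := IsScalarTower.of_algebraMap_eq fun _ => rfl
  haveI : IsScalarTower F L Δ := ⟨fun f l v => mul_assoc f.1 l.1 v⟩
  haveI : IsScalarTower L Δ Δ := ⟨fun l v w => mul_assoc l.1 v w⟩
  have hcent : ∀ z : Δ, (∀ v, z * v = v * z) → ∃ f : F, z = algebraMap F Δ f :=
    fun z hz => ⟨⟨z, Subring.mem_center_iff.mpr fun v => (hz v).symm⟩, rfl⟩
  have hmax : ∀ c : Δ, (∀ l : L, c * (l • (1:Δ)) = (l • (1:Δ)) * c) → ∃ l : L, c = l • (1:Δ) := by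
    intro c hc
    refine ⟨⟨c, (hL c).2 fun l hl => ?_⟩, (mul_one c).symm⟩
    have := hc ⟨l, hl⟩
    change c * (l * 1) = (l * 1) * c at this
    simpa using this
  -- finiteness over L
  letI : SMul E L := ⟨fun e l => (⟨e.1, hEL e.2⟩ : L) * l⟩
  haveI : IsScalarTower E L Δ := ⟨fun e l v => mul_assoc e.1 l.1 v⟩
  haveI : Module.Finite L Δ := Module.Finite.of_restrictScalars_finite E L Δ
  obtain ⟨hFΔ, -, -⟩ := lemA_finite (F := F) (L := L) hcent hmax
  by_cases hsurj : Function.Surjective (algebraMap K F)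
  · haveI : Module.Finite K F := Module.Finite.of_surjective (Algebra.linearMap K F) hsurj
    haveI : Module.Finite K Δ := Module.Finite.trans F Δ
    intro a b
    obtain ⟨k, rfl⟩ := algClosed_mem (K := K) a (Algebra.IsIntegral.isIntegral a)
    exact Algebra.commutes k b
  · obtain ⟨t, ht⟩ := not_forall.mp hsurj
    have htr : Transcendental K t := fun h => ht (algClosed_mem t h.isIntegral)
    have hinj : Function.Injective (Polynomial.aeval (R := K) t) := transcendental_iff_injective.mp htr
    let H := FractionRing (Polynomial K)
    let φ : H →+* F := IsFractionRing.lift (A := Polynomial K) (g := (Polynomial.aeval (R := K) t).toRingHom) hinj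
    have hφ : ∀ p : Polynomial K, φ (algebraMap _ H p) = Polynomial.aeval t p := fun p =>
      IsFractionRing.lift_algebraMap hinj p
    letI aHF : Algebra H F := φ.toAlgebra
    letI aHL : Algebra H L := ((algebraMap F L).comp φ).toAlgebra
    letI aHΔ : Algebra H Δ := ((algebraMap F Δ).comp φ).toAlgebra' (fun h v => Algebra.commutes (φ h) v)
    haveI : IsScalarTower H F L := IsScalarTower.of_algebraMap_eq fun _ => rfl
    haveI : IsScalarTower H F Δ := IsScalarTower.of_algebraMap_eq fun _ => rfl
    haveI : IsScalarTower H L Δ := ⟨fun f l v => mul_assoc (φ f).1 l.1 v⟩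
    haveI : IsScalarTower K H L := IsScalarTower.of_algebraMap_eq fun k => by
      change algebraMap F L (algebraMap K F k) = algebraMap F L (φ (algebraMap K H k))
      rw [IsScalarTower.algebraMap_apply K (Polynomial K) H, hφ]
      simp
    have hxL : x ∈ L := hTL (Or.inr rfl)
    let x' : L := ⟨x, hxL⟩
    let Kx := IntermediateField.adjoin K {x'}
    have hEK : ∀ e : Δ, (he : e ∈ E) → (⟨e, hEL he⟩ : L) ∈ Kx := by
      have : E ≤ Kx.toSubfield.map L.subtype := by
        rw [hE, Subfield.closure_le]
        rintro a (⟨k, rfl⟩ | rfl)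
        · exact ⟨algebraMap K L k, Kx.algebraMap_mem k, rfl⟩
        · exact ⟨x', IntermediateField.mem_adjoin_simple_self K x', rfl⟩
      intro e he
      obtain ⟨k, hk, hke⟩ := this he
      have : (⟨e, hEL he⟩ : L) = k := Subtype.ext hke.symm
      rw [this]; exact hk
    letI : SMul E Kx := ⟨fun e l => (⟨⟨e.1, hEL e.2⟩, hEK e.1 e.2⟩ : Kx) * l⟩
    haveI : IsScalarTower E Kx Δ := ⟨fun e l v => mul_assoc e.1 l.1.1 v⟩
    haveI : Module.Finite Kx Δ := Module.Finite.of_restrictScalars_finite E Kx Δ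
    haveI : IsScalarTower Kx L Δ := ⟨fun e l v => mul_assoc e.1.1 l.1 v⟩
    have hKxL : Module.Finite Kx L := Module.Finite.left Kx L Δ
    have htrL : Transcendental K (algebraMap F L t) :=
      (transcendental_algebraMap_iff (algebraMap F L).injective).mpr htr
    haveI : Module.Finite H L := finite_over_H (K := K) (H := H) (L := L) x' (algebraMap F L t) hKxL htrL
      ⟨algebraMap _ H Polynomial.X, by
        change algebraMap F L (φ _) = _
        rw [hφ, Polynomial.aeval_X]⟩
    haveI : Module.Finite H F := Module.Finite.left H F L
    have h1 : Module.finrank L Δ = 1 := tsen_abs (K := K) (H := H) (F := F) (L := L) hcent hmax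
    intro a b
    obtain ⟨v, hv⟩ := finrank_eq_one_iff'.mp h1
    obtain ⟨c1, h1⟩ := hv.2 1
    have key : ∀ a : Δ, a ∈ L := by
      intro a
      have hv1 : (c1 : Δ) * v = 1 := h1
      have hvL : v = (c1⁻¹ : L).1 := by
        have : c1 ≠ 0 := by rintro rfl; simp at hv1
        have h3 : (c1 : Δ) ≠ 0 := fun h => this (Subtype.ext h)
        change v = (c1 : Δ)⁻¹
        exact (inv_eq_of_mul_eq_one_right hv1).symm
      obtain ⟨c, hc⟩ := hv.2 a
      have hc' : (c : Δ) * v = a := hc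
      rw [← hc', hvL]
      exact mul_mem c.2 (c1⁻¹).2
    exact (hL a).1 (key a) b (key b)

end part7

section part8

theorem numeric_aux (T : ℕ → ℕ) (k : ℕ) (θ c : ℝ) (hθ0 : 0 ≤ θ) (hθ : θ < 1) (hc : 0 < c) (n0 : ℕ)
    (hT1 : ∀ n, 1 ≤ T n)
    (hgrow : ∀ n, n0 ≤ n → (T n : ℝ) * (1 + c * (n : ℝ) ^ (-θ)) ≤ T (n + k))
    (hup : ∀ n, n0 ≤ n → (T n : ℝ) ≤ (n : ℝ) ^ (3 : ℕ)) : False := by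
  obtain ⟨p, hp⟩ := exists_nat_ge (4 / (1 - θ))
  have h1θ : 0 < 1 - θ := by linarith
  have hp4 : 4 ≤ (1 - θ) * p := by
    rw [div_le_iff₀ h1θ] at hp; linarith
  have hp0 : 0 < p := by
    rcases Nat.eq_zero_or_pos p with h | h
    · subst h; norm_num at hp4
    · exact h
  have hpR : (0 : ℝ) < p := by exact_mod_cast hp0
  -- iterate
  have hit : ∀ N, n0 ≤ N → 0 < N → ∀ j, j ≤ N →
      (1 + c * (((1 + k) * N : ℕ) : ℝ) ^ (-θ)) ^ j ≤ T (N + j * k) := by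
    intro N hN hN0 j
    induction j with
    | zero => intro _; simpa using hT1 N
    | succ j ih =>
      intro hj
      have h1 := ih (by omega)
      have h2 := hgrow (N + j * k) (by omega)
      have h3 : (((1 + k) * N : ℕ) : ℝ) ^ (-θ) ≤ ((N + j * k : ℕ) : ℝ) ^ (-θ) := by
        apply Real.rpow_le_rpow_of_nonpos
        · exact_mod_cast (by omega)
        · have : j * k ≤ k * N := by nlinarith
          exact_mod_cast (by nlinarith)
        · linarith
      have h4 : (0:ℝ) ≤ (((1 + k) * N : ℕ) : ℝ) ^ (-θ) := by positivity
      have e : N + (j + 1) * k = N + j * k + k := by ring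
      rw [e, pow_succ]
      refine le_trans ?_ h2
      apply mul_le_mul h1
      · nlinarith
      · positivity
      · positivity
  set c3 : ℝ := (c * (((1 + k) * p : ℕ) : ℝ) ^ (-θ)) ^ p with hc3
  set c4 : ℝ := (((1 + k) * p : ℕ) : ℝ) ^ 3 with hc4
  have hkp : (0:ℝ) < (((1 + k) * p : ℕ) : ℝ) := by exact_mod_cast (by positivity)
  have hc3p : 0 < c3 := by positivity
  have key : ∀ j : ℕ, 0 < j → n0 ≤ j → c3 * j ≤ c4 := by
    intro j hj hnj
    have hjR : (0:ℝ) < j := by exact_mod_cast hj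
    have hj1 : (1:ℝ) ≤ j := by exact_mod_cast hj
    have hpj : n0 ≤ p * j := by nlinarith
    have h1 := hit (p * j) hpj (by positivity) (p * j) le_rfl
    have h2 := hup (p * j + p * j * k) (by nlinarith)
    have e2 : p * j + p * j * k = (1 + k) * p * j := by ring
    have e3 : (1 + k) * (p * j) = (1 + k) * p * j := by ring
    rw [e2] at h1 h2
    rw [e3] at h1
    have h3 := h1.trans h2
    set a : ℝ := c * (((1 + k) * p * j : ℕ) : ℝ) ^ (-θ) with ha
    have ha0 : 0 < a := by
      have : (0:ℝ) < (((1 + k) * p * j : ℕ) : ℝ) := by exact_mod_cast (by positivity)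
      positivity
    have h4 : (j * a) ^ p ≤ (1 + a) ^ (p * j) := by
      rw [mul_comm p j, pow_mul]
      apply pow_le_pow_left₀ (by positivity)
      have := one_add_mul_le_pow (a := a) (by linarith) j
      linarith
    have h5 : (j * a) ^ p = c3 * ((j : ℝ) ^ ((1 - θ) * p)) := by
      have : (j : ℝ) * a = (c * (((1 + k) * p : ℕ) : ℝ) ^ (-θ)) * (j : ℝ) ^ (1 - θ) := by
        rw [ha, Nat.cast_mul _ j, Real.mul_rpow hkp.le hjR.le, sub_eq_add_neg, Real.rpow_add hjR, Real.rpow_one]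
        ring
      rw [this, mul_pow, Real.rpow_mul hjR.le, Real.rpow_natCast]
    have h6 : (j : ℝ) ^ 4 ≤ (j : ℝ) ^ ((1 - θ) * p) := by
      rw [← Real.rpow_natCast]
      exact Real.rpow_le_rpow_of_exponent_le hj1 (by exact_mod_cast hp4)
    have h7 : c3 * (j:ℝ) ^ 4 ≤ c4 * (j:ℝ)^3 := by
      calc c3 * (j:ℝ) ^ 4 ≤ c3 * ((j : ℝ) ^ ((1 - θ) * p)) := by gcongr
        _ = (j * a) ^ p := h5.symm
        _ ≤ _ := h4
        _ ≤ _ := h3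
        _ = _ := by rw [hc4, Nat.cast_mul _ j, mul_pow]
    have h8 : c3 * j * (j:ℝ)^3 ≤ c4 * (j:ℝ)^3 := by nlinarith
    exact le_of_mul_le_mul_right h8 (by positivity)
  obtain ⟨j, hj⟩ := exists_nat_gt (c4 / c3)
  have h1 := key (max (max j n0) 1) (by positivity) (by simp)
  rw [div_lt_iff₀ hc3p] at hj
  have : (j:ℝ) ≤ (max (max j n0) 1 : ℕ) := by exact_mod_cast (by simp)
  nlinarith

theorem numeric (T : ℕ → ℕ) (k C : ℕ) (hT1 : ∀ n, 1 ≤ T n) (hmono : Monotone T)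
    (h : ∀ m n, T n * (m + 1) * (n + 1) + T n * (T (2 * n) + C * (m + 1) ^ 2 * (n + 1)) ≤
      T (n + k) * (T (2 * n) + C * (m + 1) ^ 2 * (n + 1)))
    (q : ℝ) (hq : q < 3) (n0 : ℕ) (hup : ∀ n, n0 ≤ n → (T n : ℝ) ≤ (n : ℝ) ^ q) : False := by
  wlog hq2 : 2 ≤ q generalizing q n0
  · refine this 2 (by norm_num) (max n0 1) (fun n hn => ?_) le_rfl
    have hn1 : (1:ℝ) ≤ n := by exact_mod_cast le_trans (le_max_right _ _) hn
    exact (hup n (le_trans (le_max_left _ _) hn)).trans (Real.rpow_le_rpow_of_exponent_le hn1 (by linarith))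
  set θ : ℝ := (q - 1) / 2 with hθ
  have hθ1 : θ < 1 := by rw [hθ]; linarith
  have hθ0 : 0 ≤ θ := by rw [hθ]; linarith
  refine numeric_aux T k θ (1 / (8 + 8 * C)) hθ0 hθ1 (by positivity) (max n0 1) hT1 ?_ ?_
  · intro n hn
    have hn1 : 1 ≤ n := le_trans (le_max_right _ _) hn
    have hnn : n0 ≤ n := le_trans (le_max_left _ _) hn
    have hn1R : (1:ℝ) ≤ n := by exact_mod_cast hn1
    have hn0 : (0:ℝ) < n := by linarith
    obtain ⟨m, hm⟩ : ∃ m, ⌈(n:ℝ) ^ θ⌉₊ = m + 1 :=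
      Nat.exists_eq_succ_of_ne_zero (Nat.ceil_pos.mpr (by positivity)).ne'
    set a : ℝ := (n:ℝ) ^ θ with ha
    have ha1 : 1 ≤ a := Real.one_le_rpow hn1R hθ0
    have hm1 : a ≤ m + 1 := by
      have := Nat.le_ceil a; rw [hm] at this; exact_mod_cast this
    have hm2 : (m:ℝ) + 1 ≤ 2 * a := by
      have := Nat.ceil_lt_add_one (show 0 ≤ a by positivity)
      rw [hm] at this
      push_cast at this
      linarith
    have hT2 : (T (2 * n) : ℝ) ≤ 8 * (a ^ 2 * n) := by
      refine (hup (2 * n) (by omega)).trans ?_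
      push_cast
      rw [Real.mul_rpow (by norm_num) hn0.le]
      have e1 : (n:ℝ) ^ q = a ^ 2 * n := by
        rw [ha, ← Real.rpow_natCast, ← Real.rpow_mul hn0.le, ← Real.rpow_add_one hn0.ne']
        congr 1
        rw [hθ]; push_cast; ring
      rw [e1]
      have e2 : (2:ℝ) ^ q ≤ 8 := by
        calc (2:ℝ) ^ q ≤ 2 ^ (3:ℝ) := Real.rpow_le_rpow_of_exponent_le (by norm_num) hq.le
          _ = 8 := by norm_num
      gcongr
    have hh : ((T n * (m + 1) * (n + 1) + T n * (T (2 * n) + C * (m + 1) ^ 2 * (n + 1)) : ℕ) : ℝ) ≤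
      ((T (n + k) * (T (2 * n) + C * (m + 1) ^ 2 * (n + 1)) : ℕ) : ℝ) := by exact_mod_cast h m n
    push_cast at hh
    set X : ℝ := (T (2 * n) : ℝ) + C * (m + 1) ^ 2 * (n + 1) with hX
    have hXle : X ≤ (8 + 8 * C) * (a ^ 2 * n) := by
      have h1 : (C:ℝ) * (m + 1) ^ 2 * (n + 1) ≤ C * (2 * a) ^ 2 * (2 * n) := by
        gcongr
        linarith
      nlinarith
    have hXpos : 0 < X := by
      have : (1:ℝ) ≤ T (2 * n) := by exact_mod_cast hT1 _
      positivity
    have hdiff : (T n : ℝ) * (a * n) ≤ (T (n + k) - T n) * X := by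
      have : (T n : ℝ) * (a * n) ≤ T n * (m + 1) * (n + 1) := by
        rw [mul_assoc]
        gcongr
        linarith
      nlinarith
    have hTm : (T n : ℝ) ≤ T (n + k) := by exact_mod_cast hmono (by omega)
    have hdiff2 : (T n : ℝ) * (a * n) ≤ (T (n + k) - T n) * ((8 + 8 * C) * (a ^ 2 * n)) :=
      hdiff.trans (mul_le_mul_of_nonneg_left hXle (by linarith))
    have hneg : (n:ℝ) ^ (-θ) = a⁻¹ := by rw [Real.rpow_neg hn0.le]
    rw [hneg]
    have h3 : (T n : ℝ) * (1 / (8 + 8 * C) * a⁻¹) ≤ T (n + k) - T n := by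
      have hpos : 0 < (8 + 8 * (C:ℝ)) * (a ^ 2 * n) := by positivity
      refine le_of_mul_le_mul_right ?_ hpos
      refine le_trans (le_of_eq ?_) hdiff2
      field_simp
    linarith
  · intro n hn
    have hn1 : (1:ℝ) ≤ n := by exact_mod_cast le_trans (le_max_right _ _) hn
    refine (hup n (le_trans (le_max_left _ _) hn)).trans ?_
    rw [← Real.rpow_natCast]
    exact Real.rpow_le_rpow_of_exponent_le hn1 (by push_cast; linarith)

end part8

section part9

section linalg
variable {R M N : Type*} [DivisionRing R] [AddCommGroup M] [Module R M] [AddCommGroup N] [Module R N]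

theorem rn_sub (f : M →ₗ[R] N) (P : Submodule R M) [Module.Finite R P] :
    Module.finrank R (P.map f) + Module.finrank R (P ⊓ LinearMap.ker f : Submodule R M) = Module.finrank R P := by
  have h := LinearMap.finrank_range_add_finrank_ker (f.domRestrict P)
  rw [LinearMap.range_domRestrict, LinearMap.ker_domRestrict] at h
  rw [← h, ← Submodule.map_comap_subtype, Submodule.finrank_map_subtype_eq]

theorem sup_map_dim (f : M →ₗ[R] N) (A : Submodule R N) (B : Submodule R M) [Module.Finite R A] [Module.Finite R B] :
    Module.finrank R (A ⊔ B.map f : Submodule R N) + Module.finrank R (B ⊓ A.comap f : Submodule R M) =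
      Module.finrank R A + Module.finrank R B := by
  have h1 := Submodule.finrank_sup_add_finrank_inf_eq A (B.map f)
  have h2 := rn_sub f B
  haveI : Module.Finite R (B ⊓ A.comap f : Submodule R M) := Submodule.finiteDimensional_inf_left _ _
  have h3 := rn_sub f (B ⊓ A.comap f)
  have e1 : (B ⊓ A.comap f).map f = A ⊓ B.map f := by
    ext n
    constructor
    · rintro ⟨b, ⟨hb, hA⟩, rfl⟩
      exact ⟨hA, b, hb, rfl⟩
    · rintro ⟨hA, b, hb, rfl⟩
      exact ⟨b, ⟨hb, hA⟩, rfl⟩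
  have e2 : B ⊓ A.comap f ⊓ LinearMap.ker f = B ⊓ LinearMap.ker f := by
    rw [inf_assoc]
    congr 1
    apply inf_eq_right.mpr
    exact LinearMap.ker_le_comap f
  rw [e1, e2] at h3
  omega

/-- codimension of a preimage -/
theorem codim_comap (f : M →ₗ[R] N) (P : Submodule R M) (B U : Submodule R N) [Module.Finite R P] [Module.Finite R B]
    (hUB : U ≤ B) (hP : P ≤ B.comap f) :
    Module.finrank R P + Module.finrank R U ≤ Module.finrank R (P ⊓ U.comap f : Submodule R M) + Module.finrank R B := by
  haveI : Module.Finite R U := Submodule.finiteDimensional_of_le hUB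
  have h := sup_map_dim f U P
  have : Module.finrank R (U ⊔ P.map f : Submodule R N) ≤ Module.finrank R B :=
    Submodule.finrank_mono (sup_le hUB (Submodule.map_le_iff_le_comap.mpr hP))
  omega
end linalg

section stab
variable {Q : Type*} [DivisionRing Q]

/-- right multiplication as a map linear over a division subring -/
def rm (D : Subfield Q) (a : Q) : Q →ₗ[D] Q where
  toFun v := v * a
  map_add' u v := add_mul _ _ _
  map_smul' l v := mul_assoc l.1 v a

@[simp] theorem rm_apply (D : Subfield Q) (a v : Q) : rm D a v = v * a := rfl

theorem rm_inj (D : Subfield Q) {a : Q} (ha : a ≠ 0) : Function.Injective (rm D a) := by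
  intro u v h
  exact mul_right_cancel₀ ha h

/-- right stabilizer of a finite-dimensional left subspace -/
def rstab (D : Subfield Q) (P : Submodule D Q) [Module.Finite D P] : Subfield Q where
  carrier := {q | ∀ p ∈ P, p * q ∈ P}
  mul_mem' {a b} ha hb p hp := by rw [← mul_assoc]; exact hb _ (ha _ hp)
  one_mem' p hp := by rwa [mul_one]
  add_mem' {a b} ha hb p hp := by rw [mul_add]; exact add_mem (ha _ hp) (hb _ hp)
  zero_mem' p hp := by rw [mul_zero]; exact zero_mem _
  neg_mem' {a} ha p hp := by rw [mul_neg]; exact neg_mem (ha _ hp)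
  inv_mem' a ha p hp := by
    by_cases h0 : a = 0
    · rw [h0, inv_zero, mul_zero]; exact zero_mem _
    let g : P →ₗ[D] P := (rm D a).restrict ha
    have hg : Function.Injective g := by
      intro u v h
      exact Subtype.ext (rm_inj D h0 (congrArg Subtype.val h))
    obtain ⟨u, hu⟩ := LinearMap.injective_iff_surjective.mp hg ⟨p, hp⟩
    have : u.1 * a = p := congrArg Subtype.val hu
    rw [← this, mul_inv_cancel_right₀ h0]
    exact u.2

theorem mem_rstab {D : Subfield Q} {P : Submodule D Q} [Module.Finite D P] {q : Q} :
    q ∈ rstab D P ↔ ∀ p ∈ P, p * q ∈ P := Iff.rfl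
end stab

end part9

section part10

section rank
variable {K Q : Type*} [Field K] [DivisionRing Q] [Algebra K Q]

/-- a subspace over a division subring containing `K`, as a `K`-subspace -/
def toK (E : Subfield Q) (hKE : ∀ k : K, algebraMap K Q k ∈ E) (H : Submodule E Q) : Submodule K Q where
  carrier := H
  add_mem' := H.add_mem
  zero_mem' := H.zero_mem
  smul_mem' k v hv := by
    have := H.smul_mem ⟨_, hKE k⟩ hv
    change algebraMap K Q k * v ∈ H at this
    rw [Algebra.smul_def]
    exact this

theorem mem_toK {E : Subfield Q} {hKE : ∀ k : K, algebraMap K Q k ∈ E} {H : Submodule E Q} {v : Q} :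
    v ∈ toK E hKE H ↔ v ∈ H := Iff.rfl

theorem not_stable [IsAlgClosed K] (E : Subfield Q) (hKE : ∀ k : K, algebraMap K Q k ∈ E) (x : Q) (hx : x ∈ E)
    (hxK : ∀ k, algebraMap K Q k ≠ x) (H : Submodule E Q) (U : Submodule K Q) [Module.Finite K U]
    (hst : ∀ u ∈ U, ∃ u' ∈ U, x * u - u' ∈ H) : ∀ u ∈ U, u ∈ H := by
  by_contra hcon
  push Not at hcon
  obtain ⟨u0, hu0, hu0H⟩ := hcon
  let H' := toK E hKE H
  have hle : H' ≤ H'.comap (LinearMap.mulLeft K x) := fun v hv => H.smul_mem ⟨x, hx⟩ hv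
  let f : (Q ⧸ H') →ₗ[K] (Q ⧸ H') := H'.mapQ H' (LinearMap.mulLeft K x) hle
  let Y := U.map H'.mkQ
  have hfY : ∀ y ∈ Y, f y ∈ Y := by
    rintro _ ⟨u, hu, rfl⟩
    obtain ⟨u', hu', h⟩ := hst u hu
    refine ⟨u', hu', ?_⟩
    rw [Submodule.mkQ_apply, Submodule.mkQ_apply]
    change _ = Submodule.Quotient.mk (x * u)
    rw [eq_comm, Submodule.Quotient.eq]
    exact h
  let g : Y →ₗ[K] Y := f.restrict hfY
  haveI : Nontrivial Y := by
    refine ⟨⟨⟨H'.mkQ u0, u0, hu0, rfl⟩, 0, fun h => hu0H ?_⟩⟩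
    have := congrArg Subtype.val h
    exact (Submodule.Quotient.mk_eq_zero H').mp this
  obtain ⟨c, hc⟩ := Module.End.exists_eigenvalue g
  obtain ⟨⟨_, u, hu, rfl⟩, hv, hne⟩ := hc.exists_hasEigenvector
  rw [Module.End.mem_eigenspace_iff] at hv
  have h1 : f (H'.mkQ u) = c • H'.mkQ u := congrArg Subtype.val hv
  have h2 : x * u - c • u ∈ H := by
    have : H'.mkQ (x * u) = H'.mkQ (c • u) := by rw [map_smul]; exact h1
    rw [Submodule.mkQ_apply, Submodule.mkQ_apply, Submodule.Quotient.eq] at this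
    exact this
  have h3 : (x - algebraMap K Q c) * u ∈ H := by rwa [sub_mul, ← Algebra.smul_def]
  have h4 : x - algebraMap K Q c ≠ 0 := fun h => hxK c (sub_eq_zero.mp h).symm
  have h5 : u ∈ H := by
    have := H.smul_mem ⟨(x - algebraMap K Q c)⁻¹, E.inv_mem (E.sub_mem hx (hKE c))⟩ h3
    change (x - algebraMap K Q c)⁻¹ * _ ∈ H at this
    rwa [inv_mul_cancel_left₀ h4] at this
  exact hne (Subtype.ext ((Submodule.Quotient.mk_eq_zero H').mpr h5))

theorem rank_lemma [IsAlgClosed K] (E : Subfield Q) (hKE : ∀ k : K, algebraMap K Q k ∈ E) (x : Q) (hx : x ∈ E)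
    (hxK : ∀ k, algebraMap K Q k ≠ x) :
    ∀ (r : ℕ) (U : Submodule K Q) (_ : Module.Finite K U) (u : Fin r → Q) (_ : ∀ i, u i ∈ U)
      (_ : LinearIndependent E u),
      Module.finrank K U + r ≤ Module.finrank K (U ⊔ U.map (LinearMap.mulLeft K x) : Submodule K Q) := by
  intro r
  induction r with
  | zero =>
    intro U _ u hu hli
    exact Submodule.finrank_mono le_sup_left
  | succ r ih =>
    intro U hU u hu hli
    let u1 : Fin r → Q := fun i => u i.castSucc
    let H := Submodule.span E (Set.range u1)
    let H' := toK E hKE H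
    let U1 := U ⊓ H'
    haveI : Module.Finite K U1 := Submodule.finiteDimensional_inf_left _ _
    have h1 := ih U1 inferInstance u1 (fun i => ⟨hu _, Submodule.subset_span ⟨i, rfl⟩⟩)
      (hli.comp _ (Fin.castSucc_injective r))
    set U2 := U ⊔ U.map (LinearMap.mulLeft K x) with hU2
    have h2 : U1 ⊔ U1.map (LinearMap.mulLeft K x) ≤ U2 ⊓ H' := by
      refine le_inf (sup_le_sup inf_le_left (Submodule.map_mono inf_le_left)) (sup_le inf_le_right ?_)
      rintro _ ⟨v, hv, rfl⟩
      exact H.smul_mem ⟨x, hx⟩ hv.2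
    haveI : Module.Finite K (U2 ⊓ H' : Submodule K Q) := Submodule.finiteDimensional_inf_left _ _
    have h3 := Submodule.finrank_mono h2
    have e1 := rn_sub H'.mkQ U
    have e2 := rn_sub H'.mkQ U2
    rw [Submodule.ker_mkQ] at e1 e2
    have h4 : U.map H'.mkQ < U2.map H'.mkQ := by
      refine lt_of_le_not_ge (Submodule.map_mono le_sup_left) fun hle => ?_
      have := not_stable E hKE x hx hxK H U (by
        intro v hv
        have : H'.mkQ (x * v) ∈ U.map H'.mkQ :=
          hle ⟨x * v, Submodule.mem_sup_right ⟨v, hv, rfl⟩, rfl⟩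
        obtain ⟨v', hv', h⟩ := this
        refine ⟨v', hv', ?_⟩
        rw [Submodule.mkQ_apply, Submodule.mkQ_apply, eq_comm, Submodule.Quotient.eq] at h
        exact h) (u (Fin.last r)) (hu _)
      have hnot := hli.notMem_span_image (s := Set.range Fin.castSucc) (x := Fin.last r) (by
        rintro ⟨i, hi⟩
        exact (Fin.castSucc_lt_last i).ne hi)
      apply hnot
      rw [← Set.range_comp]
      exact this
    have h5 := Submodule.finrank_lt_finrank_of_lt h4
    change Module.finrank K (U ⊓ H' : Submodule K Q) + r ≤ _ at h1
    omega
end rank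

end part10

section part11

section slope
variable {K Q : Type*} [Field K] [DivisionRing Q] [Algebra K Q]

theorem slope_lemma (D : Subfield Q) (hKD : ∀ k : K, algebraMap K Q k ∈ D) (U W : Submodule K Q)
    [Module.Finite K U] [Module.Finite K W] (h1W : (1 : Q) ∈ W) (k : ℕ)
    (hgrow : ∀ F P : Submodule D Q, F ≠ ⊥ → Module.Finite D P → (∀ f ∈ F, ∀ w ∈ W, f * w ∈ P) →
      k + 1 ≤ Module.finrank D P) :
    ∀ (d : ℕ) (F : Submodule D Q), Module.Finite D F → Module.finrank D F = d →
      Module.finrank K (U ⊓ toK D hKD F : Submodule K Q) * (k + 1) ≤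
        Module.finrank D F * Module.finrank K (U * W : Submodule K Q) := by
  classical
  intro d
  induction d using Nat.strong_induction_on with
  | _ d ih =>
  intro F hF hd
  by_contra hcon
  push Not at hcon
  set T := Module.finrank K (U * W : Submodule K Q) with hT
  haveI hUW : Module.Finite K (U * W : Submodule K Q) := Module.Finite.iff_fg.mpr
    ((Module.Finite.iff_fg.mp ‹Module.Finite K U›).mul (Module.Finite.iff_fg.mp ‹Module.Finite K W›))
  have hG : ∀ G ≤ F, Module.finrank K (U ⊓ toK D hKD G : Submodule K Q) * (k + 1) + Module.finrank D F * T ≤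
      Module.finrank K (U ⊓ toK D hKD F : Submodule K Q) * (k + 1) + Module.finrank D G * T := by
    intro G hGF
    rcases eq_or_lt_of_le hGF with rfl | hlt
    · exact le_rfl
    · have h1 := Submodule.finrank_lt_finrank_of_lt hlt
      have h2 := ih _ (by omega) G (Submodule.finiteDimensional_of_le hGF) rfl
      omega
  have hF0 : F ≠ ⊥ := by
    rintro rfl
    have : U ⊓ toK D hKD ⊥ = ⊥ := by
      rw [eq_bot_iff]
      rintro v ⟨_, hv⟩
      exact hv
    rw [this] at hcon
    simp at hcon
  set X := U ⊓ toK D hKD F with hX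
  haveI : Module.Finite K X := Submodule.finiteDimensional_inf_left _ _
  have step : ∀ s : Finset Q, (∀ v ∈ s, v ∈ W) → ∃ (Z : Submodule K Q) (P : Submodule D Q),
      Module.Finite D P ∧ (∀ v ∈ s, ∀ f ∈ F, f * v ∈ P) ∧ Z ≤ U * W ∧ Z ≤ toK D hKD P ∧
      Module.finrank D P * T < Module.finrank K Z * (k + 1) := by
    intro s
    induction s using Finset.induction_on with
    | empty =>
      intro _
      refine ⟨X, F, hF, by simp, ?_, inf_le_right, hcon⟩
      intro u hu
      have := Submodule.mul_mem_mul hu.1 h1W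
      rwa [mul_one] at this
    | insert v s hv ihs =>
      intro hs
      obtain ⟨Z, P, hP, hPs, hZ, hZP, hlt⟩ := ihs fun w hw => hs w (Finset.mem_insert_of_mem hw)
      haveI : Module.Finite K Z := Submodule.finiteDimensional_of_le hZ
      have hvW := hs v (Finset.mem_insert_self _ _)
      have e1 := sup_map_dim (rm D v) P F
      have e2 := sup_map_dim (LinearMap.mulRight K v) Z X
      refine ⟨Z ⊔ X.map (LinearMap.mulRight K v), P ⊔ F.map (rm D v), inferInstance, ?_, ?_, ?_, ?_⟩
      · intro w hw f hf
        rcases Finset.mem_insert.mp hw with rfl | hw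
        · exact Submodule.mem_sup_right ⟨f, hf, rfl⟩
        · exact Submodule.mem_sup_left (hPs w hw f hf)
      · refine sup_le hZ ?_
        rintro _ ⟨u, hu, rfl⟩
        exact Submodule.mul_mem_mul hu.1 hvW
      · refine sup_le (hZP.trans fun p hp => (le_sup_left : P ≤ P ⊔ F.map (rm D v)) hp) ?_
        rintro _ ⟨u, hu, rfl⟩
        exact (le_sup_right : F.map (rm D v) ≤ P ⊔ F.map (rm D v)) ⟨u, hu.2, rfl⟩
      · have h1 := hG (F ⊓ P.comap (rm D v)) inf_le_left
        have h2 : X ⊓ Z.comap (LinearMap.mulRight K v) ≤ U ⊓ toK D hKD (F ⊓ P.comap (rm D v)) := by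
          rintro u ⟨⟨hu1, hu2⟩, hu3⟩
          exact ⟨hu1, hu2, hZP hu3⟩
        haveI : Module.Finite K (U ⊓ toK D hKD (F ⊓ P.comap (rm D v)) : Submodule K Q) :=
          Submodule.finiteDimensional_inf_left _ _
        have h3 := Submodule.finrank_mono h2
        generalize Module.finrank D (P ⊔ F.map (rm D v) : Submodule D Q) = a1 at *
        generalize Module.finrank D (F ⊓ P.comap (rm D v) : Submodule D Q) = a2 at *
        generalize Module.finrank K (Z ⊔ X.map (LinearMap.mulRight K v) : Submodule K Q) = a3 at *
        generalize Module.finrank K (X ⊓ Z.comap (LinearMap.mulRight K v) : Submodule K Q) = a4 at *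
        generalize Module.finrank K (U ⊓ toK D hKD (F ⊓ P.comap (rm D v)) : Submodule K Q) = a5 at *
        have h4 := Nat.mul_le_mul_right (k + 1) h3
        have e1' := congrArg (· * T) e1
        have e2' := congrArg (· * (k + 1)) e2
        simp only [add_mul _ _ T] at e1'
        simp only [add_mul _ _ (k + 1)] at e2'
        omega
  obtain ⟨s, hs⟩ := Module.Finite.iff_fg.mp ‹Module.Finite K W›
  obtain ⟨Z, P, hP, hPs, hZ, hZP, hlt⟩ := step s (fun v hv => by rw [← hs]; exact Submodule.subset_span hv)
  have hk := hgrow F P hF0 hP (by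
    intro f hf w hw
    rw [← hs] at hw
    induction hw using Submodule.span_induction with
    | mem w hw => exact hPs w hw f hf
    | zero => rw [mul_zero]; exact zero_mem _
    | add a b _ _ ha hb => rw [mul_add]; exact add_mem ha hb
    | smul c a _ ha =>
      rw [mul_smul_comm]
      exact (toK D hKD P).smul_mem c ha)
  have hZT := Submodule.finrank_mono hZ
  rw [← hT] at hZT
  have h1 := Nat.mul_le_mul_right (k + 1) hZT
  have h2 := Nat.mul_le_mul_right T hk
  rw [mul_comm (k + 1) T] at h2
  omega

theorem grow (D : Subfield Q) (V : Submodule K Q) (h1V : (1 : Q) ∈ V)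
    (hns : ∀ P : Submodule D Q, P ≠ ⊥ → Module.Finite D P → ¬ ∀ p ∈ P, ∀ v ∈ V, p * v ∈ P) (k : ℕ) :
    ∀ F P : Submodule D Q, F ≠ ⊥ → Module.Finite D P → (∀ f ∈ F, ∀ w ∈ V ^ k, f * w ∈ P) →
      k + 1 ≤ Module.finrank D P := by
  intro F
  let Fk : ℕ → Submodule D Q := fun j => Submodule.span D {q | ∃ f ∈ F, ∃ w ∈ V ^ j, f * w = q}
  have hmono : ∀ j, Fk j ≤ Fk (j + 1) := by
    intro j
    refine Submodule.span_mono ?_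
    rintro _ ⟨f, hf, w, hw, rfl⟩
    refine ⟨f, hf, w, ?_, rfl⟩
    rw [pow_succ]
    have := Submodule.mul_mem_mul hw h1V
    rwa [mul_one] at this
  have hstep : ∀ j, ∀ p ∈ Fk j, ∀ v ∈ V, p * v ∈ Fk (j + 1) := by
    intro j p hp v hv
    have : Fk j ≤ (Fk (j + 1)).comap (rm D v) := by
      refine Submodule.span_le.mpr ?_
      rintro _ ⟨f, hf, w, hw, rfl⟩
      refine Submodule.subset_span ⟨f, hf, w * v, ?_, (mul_assoc _ _ _).symm⟩
      rw [pow_succ]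
      exact Submodule.mul_mem_mul hw hv
    exact this hp
  have key : ∀ j, F ≠ ⊥ → Module.Finite D (Fk j) → j + 1 ≤ Module.finrank D (Fk j) := by
    intro j hF0
    have hFk0 : ∀ j, Fk j ≠ ⊥ := by
      intro j h
      obtain ⟨f, hf, hf0⟩ := Submodule.exists_mem_ne_zero_of_ne_bot hF0
      have h0 : f ∈ Fk 0 := Submodule.subset_span ⟨f, hf, 1, by rw [pow_zero]; exact Submodule.one_le.mp le_rfl, mul_one f⟩
      have := monotone_nat_of_le_succ hmono (Nat.zero_le j) h0
      rw [h] at this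
      exact hf0 this
    induction j with
    | zero =>
      intro hfin
      rw [zero_add, Nat.one_le_iff_ne_zero]
      intro h
      exact hFk0 0 (Submodule.finrank_eq_zero.mp h)
    | succ j ihj =>
      intro hfin
      have hfj : Module.Finite D (Fk j) := Submodule.finiteDimensional_of_le (hmono j)
      have h1 := ihj hfj
      have hlt : Fk j < Fk (j + 1) := by
        refine lt_of_le_of_ne (hmono j) fun heq => ?_
        refine hns (Fk j) (hFk0 j) hfj fun p hp v hv => ?_
        rw [heq]
        exact hstep j p hp v hv
      have h2 := Submodule.finrank_lt_finrank_of_lt hlt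
      omega
  intro P hF0 hP hFP
  have hle : Fk k ≤ P := by
    refine Submodule.span_le.mpr ?_
    rintro _ ⟨f, hf, w, hw, rfl⟩
    exact hFP f hf w hw
  exact (key k hF0 (Submodule.finiteDimensional_of_le hle)).trans (Submodule.finrank_mono hle)
end slope

end part11

section part12

section reach
variable {K Q : Type*} [Field K] [DivisionRing Q] [Algebra K Q]

/-- sets of words in `x`, `y` reached from `1` by left multiplications -/
inductive Reach (x y : Q) : ℕ → Set Q → Prop
  | base : Reach x y 0 {1}
  | step {N : ℕ} {S : Set Q} {s w : Q} : Reach x y N S → s ∈ S → (w = x ∨ w = y) →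
      Reach x y (N + 1) (insert (w * s) S)

theorem reach_codim (x y : Q) (U B : Submodule K Q) [Module.Finite K B] (hUB : U ≤ B)
    (hx : ∀ u ∈ U, x * u ∈ B) (hy : ∀ u ∈ U, y * u ∈ B) {N : ℕ} {S : Set Q} (h : Reach x y N S) :
    ∃ US : Submodule K Q, US ≤ U ∧ (∀ u ∈ US, ∀ s ∈ S, s * u ∈ U) ∧
      Module.finrank K U + N * Module.finrank K U ≤ Module.finrank K US + N * Module.finrank K B := by
  induction h with
  | base =>
    refine ⟨U, le_rfl, ?_, by simp⟩
    intro u hu s hs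
    rw [Set.mem_singleton_iff.mp hs, one_mul]
    exact hu
  | @step N S s w hr hs hw ih =>
    obtain ⟨US, hle, hS, hd⟩ := ih
    haveI : Module.Finite K US := Submodule.finiteDimensional_of_le (hle.trans hUB)
    have hc := codim_comap (LinearMap.mulLeft K (w * s)) US B U hUB (by
      intro u hu
      rw [Submodule.mem_comap, LinearMap.mulLeft_apply, mul_assoc]
      rcases hw with rfl | rfl
      · exact hx _ (hS u hu s hs)
      · exact hy _ (hS u hu s hs))
    refine ⟨US ⊓ U.comap (LinearMap.mulLeft K (w * s)), inf_le_left.trans hle, ?_, ?_⟩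
    rotate_left
    · rw [add_mul, add_mul]
      omega
    · rintro u ⟨hu1, hu2⟩ t ht
      rcases Set.mem_insert_iff.mp ht with rfl | ht
      · exact hu2
      · exact hS u hu1 t ht

theorem reach_pow (x y : Q) {N : ℕ} {S : Set Q} (h : Reach x y N S) {s : Q} (hs : s ∈ S) (k : ℕ) :
    ∃ S', Reach x y (N + k) S' ∧ S ⊆ S' ∧ x ^ k * s ∈ S' := by
  induction k with
  | zero => exact ⟨S, h, subset_rfl, by simpa using hs⟩
  | succ k ih =>
    obtain ⟨S', h', hss, hk⟩ := ih
    refine ⟨_, h'.step hk (Or.inl rfl), hss.trans (Set.subset_insert _ _), ?_⟩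
    rw [pow_succ', mul_assoc]
    exact Set.mem_insert _ _

theorem li_of_step {E : Subfield Q} (v : ℕ → Q) (hv : ∀ n, v n ∉ Submodule.span E (v '' Set.Iio n)) (m : ℕ) :
    LinearIndependent E (fun i : Fin m => v i) := by
  induction m with
  | zero => exact linearIndependent_empty_type
  | succ m ih =>
    rw [linearIndependent_fin_succ']
    refine ⟨ih, fun hmem => hv m ?_⟩
    refine Submodule.span_mono ?_ hmem
    rintro _ ⟨i, rfl⟩
    exact ⟨i, i.2, rfl⟩

/-- left stabilizer of a finite-dimensional left subspace containing `1` -/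
def lstab (E : Subfield Q) (P : Submodule E Q) [Module.Finite E P] (h1 : (1 : Q) ∈ P) : Subfield Q :=
  let R : Submodule E Q :=
    { carrier := {q | ∀ p ∈ P, q * p ∈ P}
      add_mem' := fun {a b} ha hb p hp => by rw [add_mul]; exact add_mem (ha _ hp) (hb _ hp)
      zero_mem' := fun p hp => by rw [zero_mul]; exact zero_mem _
      smul_mem' := fun e a ha p hp => by
        change (e.1 * a) * p ∈ P
        rw [mul_assoc]
        exact P.smul_mem e (ha p hp) }
  have hR : Module.Finite E R := Submodule.finiteDimensional_of_le (S₂ := P) fun q hq => by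
    have := hq 1 h1
    rwa [mul_one] at this
  { carrier := {q | ∀ p ∈ P, q * p ∈ P}
    mul_mem' := fun {a b} ha hb p hp => by rw [mul_assoc]; exact ha _ (hb _ hp)
    one_mem' := fun p hp => by rwa [one_mul]
    add_mem' := fun {a b} ha hb p hp => by rw [add_mul]; exact add_mem (ha _ hp) (hb _ hp)
    zero_mem' := fun p hp => by rw [zero_mul]; exact zero_mem _
    neg_mem' := fun {a} ha p hp => by rw [neg_mul]; exact neg_mem (ha _ hp)
    inv_mem' := fun a ha => by
      have h2 : a ∈ rstab E R := fun r hr p hp => by rw [mul_assoc]; exact hr _ (ha _ hp)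
      have h3 := (rstab E R).inv_mem h2
      have h4 := h3 1 (show (1 : Q) ∈ R from fun p hp => by rwa [one_mul])
      rw [one_mul] at h4
      exact h4 }

theorem mem_lstab {E : Subfield Q} {P : Submodule E Q} [Module.Finite E P] {h1 : (1 : Q) ∈ P} {q : Q} :
    q ∈ lstab E P h1 ↔ ∀ p ∈ P, q * p ∈ P := Iff.rfl

theorem comm_of_stable [IsAlgClosed K] (x y : Q) (E : Subfield Q)
    (hE : E = Subfield.closure (Set.range (algebraMap K Q) ∪ {x})) (P : Submodule E Q) [Module.Finite E P]
    (h1 : (1 : Q) ∈ P) (hy : ∀ p ∈ P, y * p ∈ P) : x * y = y * x := by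
  classical
  let R0 := lstab E P h1
  have hER : E ≤ R0 := fun e he p hp => P.smul_mem ⟨e, he⟩ hp
  have hKE : ∀ k : K, algebraMap K Q k ∈ E := fun k => by
    rw [hE]; exact Subfield.subset_closure (Or.inl ⟨k, rfl⟩)
  have hxE : x ∈ E := by rw [hE]; exact Subfield.subset_closure (Or.inr rfl)
  let φ : K →+* R0 := (algebraMap K Q).codRestrict R0 fun k => hER (hKE k)
  letI : Algebra K R0 := φ.toAlgebra' fun k r => Subtype.ext (Algebra.commutes k r.1)
  let x' : R0 := ⟨x, hER hxE⟩
  let E' : Subfield R0 := Subfield.closure (Set.range (algebraMap K R0) ∪ {x'})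
  have hEE' : ∀ (e : Q) (he : e ∈ E), (⟨e, hER he⟩ : R0) ∈ E' := by
    have hle : E ≤ E'.map R0.subtype := by
      conv_lhs => rw [hE]
      rw [Subfield.closure_le]
      rintro _ (⟨k, rfl⟩ | rfl)
      · exact ⟨algebraMap K R0 k, Subfield.subset_closure (Or.inl ⟨k, rfl⟩), rfl⟩
      · exact ⟨x', Subfield.subset_closure (Or.inr rfl), rfl⟩
    intro e he
    obtain ⟨e', he', h⟩ := hle he
    have : (⟨e, hER he⟩ : R0) = e' := Subtype.ext h.symm
    rw [this]
    exact he'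
  have hfin : Module.Finite E' R0 := by
    let R : Submodule E Q :=
      { carrier := R0
        add_mem' := R0.add_mem
        zero_mem' := R0.zero_mem
        smul_mem' := fun e a ha => R0.mul_mem (hER e.2) ha }
    have hR : Module.Finite E R := Submodule.finiteDimensional_of_le (S₂ := P) fun q hq => by
      have : q * 1 ∈ P := hq 1 h1
      rwa [mul_one] at this
    obtain ⟨t, ht⟩ := Module.Finite.iff_fg.mp hR
    have htR : ∀ q ∈ Submodule.span E (t : Set Q), q ∈ R0 := fun q hq => by rw [ht] at hq; exact hq
    let t' : Set R0 := Subtype.val ⁻¹' (t : Set Q)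
    have ht' : t'.Finite := t.finite_toSet.preimage Subtype.val_injective.injOn
    have key : ∀ q ∈ Submodule.span E (t : Set Q), ∀ h : q ∈ R0, (⟨q, h⟩ : R0) ∈ Submodule.span E' t' := by
      intro q hq
      induction hq using Submodule.span_induction with
      | mem q hq => intro h; exact Submodule.subset_span hq
      | zero => intro h; exact zero_mem _
      | add a b ha hb iha ihb =>
        intro h
        exact add_mem (iha (htR a ha)) (ihb (htR b hb))
      | smul e a ha iha =>
        intro h
        exact Submodule.smul_mem _ (⟨⟨e.1, hER e.2⟩, hEE' _ e.2⟩ : E') (iha (htR a ha))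
    refine ⟨⟨ht'.toFinset, ?_⟩⟩
    rw [Set.Finite.coe_toFinset, eq_top_iff]
    rintro ⟨q, hq⟩ _
    exact key q (by rw [ht]; exact hq) hq
  have := tsen x' E' rfl hfin x' ⟨y, hy⟩
  exact congrArg Subtype.val this

theorem reach_exists [IsAlgClosed K] (x y : Q) (hxy : x * y ≠ y * x) (E : Subfield Q)
    (hE : E = Subfield.closure (Set.range (algebraMap K Q) ∪ {x})) :
    ∃ C : ℕ, ∀ m : ℕ, ∃ N S, Reach x y N S ∧ N ≤ C * (m + 1) ∧
      ∃ s : Fin (m + 1) → Q, (∀ i, s i ∈ S) ∧ LinearIndependent E s := by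
  classical
  have hKE : ∀ k : K, algebraMap K Q k ∈ E := fun k => by
    rw [hE]; exact Subfield.subset_closure (Or.inl ⟨k, rfl⟩)
  have hxE : x ∈ E := by rw [hE]; exact Subfield.subset_closure (Or.inr rfl)
  by_cases hcase : ∀ n, y * x ^ n ∉ Submodule.span E ((fun n => y * x ^ n) '' Set.Iio n)
  · refine ⟨2, fun m => ?_⟩
    have key : ∀ m, ∃ S, Reach x y (2 * m) S ∧ x ^ m ∈ S ∧ ∀ i < m, y * x ^ i ∈ S := by
      intro m
      induction m with
      | zero => exact ⟨{1}, .base, by simp, by simp⟩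
      | succ m ih =>
        obtain ⟨S, hS, hx, hi⟩ := ih
        refine ⟨_, (hS.step hx (Or.inr rfl)).step (Set.mem_insert_of_mem _ hx) (Or.inl rfl), ?_, ?_⟩
        · rw [pow_succ']; exact Set.mem_insert _ _
        · intro i hlt
          rcases Nat.lt_succ_iff_lt_or_eq.mp hlt with h | rfl
          · exact Set.mem_insert_of_mem _ (Set.mem_insert_of_mem _ (hi i h))
          · exact Set.mem_insert_of_mem _ (Set.mem_insert _ _)
    obtain ⟨S, hS, _, hi⟩ := key (m + 1)
    exact ⟨_, S, hS, le_rfl, fun i => y * x ^ (i : ℕ), fun i => hi i i.2,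
      li_of_step (fun n => y * x ^ n) hcase (m + 1)⟩
  · push Not at hcase
    obtain ⟨n, hn⟩ := hcase
    let P0 := Submodule.span E ((fun n => y * x ^ n) '' Set.Iio n)
    haveI : Module.Finite E P0 := Module.Finite.span_of_finite E ((Set.finite_Iio n).image _)
    have hxs : x ∈ rstab E P0 := by
      intro p hp
      have : P0 ≤ P0.comap (rm E x) := by
        refine Submodule.span_le.mpr ?_
        rintro _ ⟨i, hi, rfl⟩
        change y * x ^ i * x ∈ P0
        rw [mul_assoc, ← pow_succ]
        rcases Nat.lt_or_ge (i + 1) n with h | h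
        · exact Submodule.subset_span ⟨i + 1, h, rfl⟩
        · have : i + 1 = n := le_antisymm hi h
          rw [this]; exact hn
      exact this hp
    have hEs : E ≤ rstab E P0 := by
      conv_lhs => rw [hE]
      rw [Subfield.closure_le]
      rintro _ (⟨k, rfl⟩ | rfl)
      · intro p hp
        rw [← Algebra.commutes]
        exact P0.smul_mem ⟨_, hKE k⟩ hp
      · exact hxs
    have hn0 : n ≠ 0 := by
      rintro rfl
      simp at hn
      apply hxy
      simp [hn]
    have hyP0 : y ∈ P0 := Submodule.subset_span ⟨0, Nat.pos_of_ne_zero hn0, by simp⟩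
    have hyE : ∀ e ∈ E, y * e ∈ P0 := fun e he => hEs he y hyP0
    refine ⟨n + 1, fun m => ?_⟩
    suffices h : ∃ N S, Reach x y N S ∧ N ≤ (n + 1) * m ∧ ∃ s : Fin (m + 1) → Q, s 0 = 1 ∧ (∀ i, s i ∈ S) ∧
        LinearIndependent E s by
      obtain ⟨N, S, h1, h2, s, h3, h4, h5⟩ := h
      exact ⟨N, S, h1, h2.trans (Nat.mul_le_mul_left _ (Nat.le_succ m)), s, h4, h5⟩
    induction m with
    | zero =>
      refine ⟨0, {1}, .base, by simp, fun _ => 1, rfl, fun _ => rfl, ?_⟩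
      haveI : Unique (Fin (0 + 1)) := inferInstanceAs (Unique (Fin 1))
      exact linearIndependent_unique_iff |>.mpr one_ne_zero
    | succ m ih =>
      obtain ⟨N, S, hr, hN, s, hs0, hsS, hli⟩ := ih
      let P := Submodule.span E (Set.range s)
      haveI : Module.Finite E P := Module.Finite.span_of_finite E (Set.finite_range s)
      by_cases hall : ∀ i, ∀ k < n, y * x ^ k * s i ∈ P
      · exfalso
        apply hxy
        refine comm_of_stable (K := K) x y E hE P (Submodule.subset_span ⟨0, hs0⟩) ?_
        have hi : ∀ i, ∀ p ∈ P0, p * s i ∈ P := by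
          intro i p hp
          have : P0 ≤ P.comap (rm E (s i)) := by
            refine Submodule.span_le.mpr ?_
            rintro _ ⟨k, hk, rfl⟩
            exact hall i k hk
          exact this hp
        have : ∀ p ∈ P, ∀ e ∈ E, y * (e * p) ∈ P := by
          intro p hp
          induction hp using Submodule.span_induction with
          | mem p hp =>
            obtain ⟨i, rfl⟩ := hp
            intro e he
            rw [← mul_assoc]
            exact hi i _ (hyE e he)
          | zero => intro e he; rw [mul_zero, mul_zero]; exact zero_mem _
          | add a b _ _ iha ihb =>
            intro e he
            rw [mul_add, mul_add]; exact add_mem (iha e he) (ihb e he)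
          | smul c a _ iha =>
            intro e he
            change y * (e * (c.1 * a)) ∈ P
            rw [← mul_assoc e]
            exact iha _ (E.mul_mem he c.2)
        intro p hp
        have h := this p hp 1 E.one_mem
        rwa [one_mul] at h
      · push Not at hall
        obtain ⟨i, k, hk, hnot⟩ := hall
        obtain ⟨S', hr', hSS, hks⟩ := reach_pow x y hr (hsS i) k
        refine ⟨_, _, hr'.step hks (Or.inr rfl), ?_, Fin.snoc s (y * x ^ k * s i), ?_, ?_, ?_⟩
        · rw [mul_add, mul_one]; omega
        · have : (0 : Fin (m + 1 + 1)) = Fin.castSucc 0 := rfl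
          rw [this, Fin.snoc_castSucc, hs0]
        · intro j
          refine Fin.lastCases ?_ (fun j => ?_) j
          · rw [Fin.snoc_last, mul_assoc]; exact Set.mem_insert _ _
          · rw [Fin.snoc_castSucc]; exact Set.mem_insert_of_mem _ (hSS (hsS j))
        · rw [linearIndependent_finSnoc]
          exact ⟨hli, hnot⟩
end reach

end part12

section part13

section combine
variable {K Q : Type*} [Field K] [DivisionRing Q] [Algebra K Q]

theorem prod_indep {E D : Subfield Q} {a b : ℕ} (s : Fin a → Q) (u : Fin b → Q) (hED : E ≤ D)
    (hsD : ∀ i, s i ∈ D) (hs : LinearIndependent E s) (hu : LinearIndependent D u) :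
    LinearIndependent E (fun p : Fin a × Fin b => s p.1 * u p.2) := by
  rw [Fintype.linearIndependent_iff] at hs hu ⊢
  intro g hg
  have h1 : ∀ j, ∑ i, g (i, j) • s i = 0 := by
    intro j
    have := hu (fun j => ⟨∑ i, g (i, j) • s i, sum_mem fun i _ => D.mul_mem (hED (g (i, j)).2) (hsD i)⟩) (by
      rw [← hg, Fintype.sum_prod_type_right]
      refine Finset.sum_congr rfl fun j _ => ?_
      change (∑ i, g (i, j) • s i) * u j = _
      rw [Finset.sum_mul]
      refine Finset.sum_congr rfl fun i _ => ?_
      change (g (i, j)).1 * s i * u j = (g (i, j)).1 * (s i * u j)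
      rw [mul_assoc]) j
    exact congrArg Subtype.val this
  rintro ⟨i, j⟩
  exact hs (fun i => g (i, j)) (h1 j) i

theorem main_step [IsAlgClosed K] (D : Subfield Q) (hKD : ∀ k : K, algebraMap K Q k ∈ D) (x y : Q) (hxD : x ∈ D) (hyD : y ∈ D)
    (E : Subfield Q) (hE : E = Subfield.closure (Set.range (algebraMap K Q) ∪ {x}))
    (hxK : ∀ k : K, algebraMap K Q k ≠ x) (V : Submodule K Q) [Module.Finite K V] (h1V : (1 : Q) ∈ V)
    (hns : ∀ P : Submodule D Q, P ≠ ⊥ → Module.Finite D P → ¬ ∀ p ∈ P, ∀ v ∈ V, p * v ∈ P)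
    (m n N : ℕ) (S : Set Q) (hr : Reach x y N S) (s : Fin (m + 1) → Q) (hsS : ∀ i, s i ∈ S) (hs : LinearIndependent E s)
    (B : Submodule K Q) [Module.Finite K B] (hUB : V ^ n ≤ B) (hx : ∀ u ∈ V ^ n, x * u ∈ B) (hy : ∀ u ∈ V ^ n, y * u ∈ B) :
    ∃ ρ d : ℕ, Module.finrank K (V ^ n : Submodule K Q) + N * Module.finrank K (V ^ n : Submodule K Q) ≤
        d + N * Module.finrank K B ∧
      d * (n + 1) ≤ ρ * Module.finrank K (V ^ (2 * n) : Submodule K Q) ∧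
      Module.finrank K (V ^ n : Submodule K Q) + (m + 1) * ρ ≤ Module.finrank K B := by
  classical
  have hKE : ∀ k : K, algebraMap K Q k ∈ E := fun k => by
    rw [hE]; exact Subfield.subset_closure (Or.inl ⟨k, rfl⟩)
  have hxE : x ∈ E := by rw [hE]; exact Subfield.subset_closure (Or.inr rfl)
  have hED : E ≤ D := by
    rw [hE, Subfield.closure_le]
    rintro _ (⟨k, rfl⟩ | rfl)
    · exact hKD k
    · exact hxD
  have hSD : ∀ (N : ℕ) (S : Set Q), Reach x y N S → ∀ s ∈ S, s ∈ D := by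
    intro N S h
    induction h with
    | base => intro s hs; rw [Set.mem_singleton_iff.mp hs]; exact D.one_mem
    | @step N S s w hr hs hw ih =>
      intro t ht
      rcases Set.mem_insert_iff.mp ht with rfl | ht
      · rcases hw with rfl | rfl
        · exact D.mul_mem hxD (ih s hs)
        · exact D.mul_mem hyD (ih s hs)
      · exact ih t ht
  obtain ⟨US, hle, hUS, hcod⟩ := reach_codim x y (V ^ n) B hUB hx hy hr
  haveI hUfin : Module.Finite K (V ^ n : Submodule K Q) := Submodule.finiteDimensional_of_le hUB
  haveI hUSfin : Module.Finite K US := Submodule.finiteDimensional_of_le hle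
  let F : Submodule D Q := Submodule.span D (US : Set Q)
  haveI hFfin : Module.Finite D F := by
    obtain ⟨t, ht⟩ := Module.Finite.iff_fg.mp hUSfin
    have hFt : F ≤ Submodule.span D (t : Set Q) := by
      refine Submodule.span_le.mpr fun u hu => ?_
      have h2 : US ≤ toK D hKD (Submodule.span D (t : Set Q)) := by
        rw [← ht]
        exact Submodule.span_le.mpr Submodule.subset_span
      exact h2 hu
    haveI := Module.Finite.span_of_finite D t.finite_toSet
    exact Submodule.finiteDimensional_of_le hFt
  obtain ⟨u, huS, hspan, hu⟩ : ∃ u : Fin (Module.finrank D F) → Q, (∀ i, u i ∈ US) ∧ True ∧ LinearIndependent D u := by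
    obtain ⟨b, hb1, hb2, hb3⟩ := exists_linearIndependent D (US : Set Q)
    have hb4 : Submodule.span D b = F := hb2
    have hbF : ∀ v : b, v.1 ∈ F := fun v => Submodule.subset_span (hb1 v.2)
    have hfb : Finite b := by
      have : LinearIndependent D (fun v : b => (⟨v.1, hbF v⟩ : F)) :=
        LinearIndependent.of_comp F.subtype hb3
      exact this.finite
    haveI := Fintype.ofFinite b
    have hcard : Fintype.card b = Module.finrank D F := by
      rw [← hb4]
      have := finrank_span_eq_card hb3
      rw [Subtype.range_coe] at this
      exact this.symm
    let e : Fin (Module.finrank D F) ≃ b := (Fintype.equivFinOfCardEq hcard).symm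
    exact ⟨fun i => (e i).1, fun i => hb1 (e i).2, trivial, hb3.comp e e.injective⟩
  refine ⟨Module.finrank D F, Module.finrank K US, hcod, ?_, ?_⟩
  · have hsl := slope_lemma D hKD US (V ^ n) (by
        have : ∀ n, (1 : Q) ∈ V ^ n := fun n => by
          induction n with
          | zero => rw [pow_zero]; exact Submodule.one_le.mp le_rfl
          | succ n ih =>
            rw [pow_succ]
            have := Submodule.mul_mem_mul ih h1V
            rwa [mul_one] at this
        exact this n) n (grow D V h1V hns n) _ F hFfin rfl
    have hinf : US ⊓ toK D hKD F = US := inf_eq_left.mpr fun v hv => Submodule.subset_span hv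
    rw [hinf] at hsl
    refine hsl.trans (Nat.mul_le_mul_left _ ?_)
    haveI : Module.Finite K (V ^ (2 * n) : Submodule K Q) :=
      Module.Finite.iff_fg.mpr ((Module.Finite.iff_fg.mp ‹Module.Finite K V›).pow _)
    refine Submodule.finrank_mono ?_
    rw [two_mul, pow_add]
    exact mul_le_mul_left hle _
  · have hpi := prod_indep s u hED (fun i => hSD N S hr _ (hsS i)) hs hu
    let e : Fin ((m + 1) * Module.finrank D F) ≃ Fin (m + 1) × Fin (Module.finrank D F) := finProdFinEquiv.symm
    have := rank_lemma E hKE x hxE hxK _ (V ^ n) hUfin (fun i => s (e i).1 * u (e i).2)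
      (fun i => hUS _ (huS _) _ (hsS _)) (hpi.comp e e.injective)
    refine this.trans (Submodule.finrank_mono (sup_le hUB ?_))
    rintro _ ⟨v, hv, rfl⟩
    exact hx v hv
end combine

end part13

theorem ineq_arith (t N d b ρ t2 tk m n C : ℕ) (h1 : t + N * t ≤ d + N * b) (h2 : d * (n + 1) ≤ ρ * t2)
    (h3 : t + (m + 1) * ρ ≤ b) (hb : b ≤ tk) (hN : N ≤ C * (m + 1)) :
    t * (m + 1) * (n + 1) + t * (t2 + C * (m + 1) ^ 2 * (n + 1)) ≤ tk * (t2 + C * (m + 1) ^ 2 * (n + 1)) := by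
  obtain ⟨δ, rfl⟩ := Nat.exists_eq_add_of_le (show t ≤ b by omega)
  have h4 : (m + 1) * ρ ≤ δ := by omega
  have h5 : t ≤ d + N * δ := by rw [mul_add] at h1; omega
  have h6 : t * (m + 1) * (n + 1) ≤ δ * (t2 + C * (m + 1) ^ 2 * (n + 1)) := by
    calc t * (m + 1) * (n + 1) ≤ (d + N * δ) * (m + 1) * (n + 1) := by gcongr
      _ = d * (n + 1) * (m + 1) + N * δ * (m + 1) * (n + 1) := by ring
      _ ≤ ρ * t2 * (m + 1) + C * (m + 1) * δ * (m + 1) * (n + 1) := by gcongr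
      _ = (m + 1) * ρ * t2 + δ * (C * (m + 1) ^ 2 * (n + 1)) := by ring
      _ ≤ δ * t2 + δ * (C * (m + 1) ^ 2 * (n + 1)) := by gcongr
      _ = _ := by ring
  calc _ ≤ δ * (t2 + C * (m + 1) ^ 2 * (n + 1)) + t * (t2 + C * (m + 1) ^ 2 * (n + 1)) := by gcongr
    _ = (t + δ) * (t2 + C * (m + 1) ^ 2 * (n + 1)) := by ring
    _ ≤ _ := by gcongr

theorem gk_bound (T : ℕ → ℕ) (hT1 : ∀ n, 1 ≤ T n)
    (h : Filter.limsup (fun n : ℕ => ((Real.log (T n) / Real.log n : ℝ) : EReal)) atTop < 3) :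
    ∃ q : ℝ, q < 3 ∧ ∃ n0 : ℕ, ∀ n, n0 ≤ n → (T n : ℝ) ≤ (n : ℝ) ^ q := by
  obtain ⟨q, hq1, hq2⟩ := EReal.lt_iff_exists_real_btwn.mp h
  refine ⟨q, EReal.coe_lt_coe_iff.mp (by
    have h3 : ((3 : ℝ) : EReal) = 3 := rfl
    rw [h3]; exact hq2), ?_⟩
  have hev := Filter.eventually_lt_of_limsup_lt hq1
  obtain ⟨n0, hn0⟩ := Filter.eventually_atTop.mp hev
  refine ⟨max n0 2, fun n hn => ?_⟩
  have h1 : Real.log (T n) / Real.log n < q := by exact_mod_cast hn0 n (le_of_max_le_left hn)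
  have hn2 : (2 : ℝ) ≤ n := by exact_mod_cast le_of_max_le_right hn
  have hlog : 0 < Real.log n := Real.log_pos (by linarith)
  rw [div_lt_iff₀ hlog] at h1
  have hTpos : (0 : ℝ) < T n := by exact_mod_cast hT1 n
  rw [Real.rpow_def_of_pos (by linarith), ← Real.log_le_iff_le_exp hTpos]
  linarith

theorem pow_mono_one {K Q : Type*} [Field K] [DivisionRing Q] [Algebra K Q] (V : Submodule K Q) (h1V : (1 : Q) ∈ V) :
    Monotone fun n => V ^ n := by
  refine monotone_nat_of_le_succ fun n v hv => ?_
  rw [pow_succ]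
  have := Submodule.mul_mem_mul hv h1V
  rwa [mul_one] at this

theorem mem_pow_of_adjoin {K Q : Type*} [Field K] [DivisionRing Q] [Algebra K Q] (V : Submodule K Q)
    (h1V : (1 : Q) ∈ V) (a : Q) (ha : a ∈ Algebra.adjoin K (V : Set Q)) : ∃ n, a ∈ V ^ n := by
  have hm := pow_mono_one V h1V
  induction ha using Algebra.adjoin_induction with
  | mem v hv => exact ⟨1, by rw [pow_one]; exact hv⟩
  | algebraMap k => exact ⟨0, by rw [pow_zero]; exact Submodule.algebraMap_mem k⟩
  | add a b _ _ iha ihb =>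
    obtain ⟨i, hi⟩ := iha
    obtain ⟨j, hj⟩ := ihb
    exact ⟨max i j, add_mem (hm (le_max_left i j) hi) (hm (le_max_right i j) hj)⟩
  | mul a b _ _ iha ihb =>
    obtain ⟨i, hi⟩ := iha
    obtain ⟨j, hj⟩ := ihb
    exact ⟨i + j, by rw [pow_add]; exact Submodule.mul_mem_mul hi hj⟩

theorem stmt13 {K Q : Type*} [Field K] [IsAlgClosed K] [DivisionRing Q] [Algebra K Q]
    (A : Subalgebra K Q)
    (V : Submodule K Q) (hVfin : FiniteDimensional K ↥V) (h1V : (1 : Q) ∈ V)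
    (hVA : Algebra.adjoin K (V : Set Q) = A)
    (hGKA : gkWrt K V < 3)
    (hQuot : ∀ q : Q, ∃ a ∈ A, ∃ b ∈ A, b ≠ 0 ∧ q = b⁻¹ * a)
    (D : Subring Q) (hDK : ∀ c : K, algebraMap K Q c ∈ D)
    (hDinv : ∀ x ∈ D, x⁻¹ ∈ D)
    -- `Q` is infinite-dimensional as a left `D`-vector space:
    (hinf : ¬ ∃ s : Finset Q, ∀ q : Q, ∃ c : Q → Q,
      (∀ x ∈ s, c x ∈ D) ∧ q = ∑ x ∈ s, c x * x) :
    ∀ x ∈ D, ∀ y ∈ D, x * y = y * x := by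
  classical
  intro x hx y hy
  by_contra hxy
  have hm := pow_mono_one V h1V
  let D' : Subfield Q := { D with inv_mem' := hDinv }
  let E : Subfield Q := Subfield.closure (Set.range (algebraMap K Q) ∪ {x})
  have hxK : ∀ k : K, algebraMap K Q k ≠ x := by
    rintro k rfl
    exact hxy (Algebra.commutes k y)
  have hns : ∀ P : Submodule D' Q, P ≠ ⊥ → Module.Finite D' P → ¬ ∀ p ∈ P, ∀ v ∈ V, p * v ∈ P := by
    intro P hP0 hPf hst
    apply hinf
    have hKs : ∀ k : K, algebraMap K Q k ∈ rstab D' P := by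
      intro k p hp
      rw [← Algebra.commutes]
      exact P.smul_mem ⟨_, hDK k⟩ hp
    have hA : ∀ a ∈ A, a ∈ rstab D' P := by
      intro a ha
      rw [← hVA] at ha
      induction ha using Algebra.adjoin_induction with
      | mem v hv => exact fun p hp => hst p hp v hv
      | algebraMap k => exact hKs k
      | add a b _ _ iha ihb => exact add_mem iha ihb
      | mul a b _ _ iha ihb => exact mul_mem iha ihb
    have hall : ∀ q, q ∈ rstab D' P := by
      intro q
      obtain ⟨a, ha, b, hb, _, rfl⟩ := hQuot q
      exact mul_mem (inv_mem (hA b hb)) (hA a ha)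
    have htop : ∀ q, q ∈ P := by
      intro q
      obtain ⟨p, hp, hp0⟩ := Submodule.exists_mem_ne_zero_of_ne_bot hP0
      have := hall (p⁻¹ * q) p hp
      rwa [mul_inv_cancel_left₀ hp0] at this
    obtain ⟨t, ht⟩ := Module.Finite.iff_fg.mp hPf
    refine ⟨t, fun q => ?_⟩
    have hq := htop q
    rw [← ht, Submodule.mem_span_finset'] at hq
    obtain ⟨f, hf⟩ := hq
    refine ⟨fun z => if h : z ∈ t then (f ⟨z, h⟩ : Q) else 0, ?_, ?_⟩
    · intro z hz
      beta_reduce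
      rw [dif_pos hz]
      exact (f ⟨z, hz⟩).2
    · rw [← hf, ← Finset.sum_coe_sort t]
      refine Finset.sum_congr rfl fun z _ => ?_
      beta_reduce
      rw [dif_pos z.2]
      rfl
  obtain ⟨C, hC⟩ := reach_exists (K := K) x y hxy E rfl
  obtain ⟨k0, b, hb0, hb1, hb2, hb3⟩ : ∃ (k0 : ℕ) (b : Q), b ≠ 0 ∧ b ∈ V ^ k0 ∧ b * x ∈ V ^ k0 ∧ b * y ∈ V ^ k0 := by
    obtain ⟨a1, ha1, b1, hb1, hb10, hx1⟩ := hQuot x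
    obtain ⟨a2, ha2, b2, hb2, hb20, hy1⟩ := hQuot y
    obtain ⟨α, hα, β, hβ, hβ0, h⟩ := hQuot (b1 * b2⁻¹)
    have hbb : β * b1 = α * b2 := by
      have : β * (b1 * b2⁻¹) * b2 = β * (β⁻¹ * α) * b2 := by rw [h]
      rwa [mul_inv_cancel_left₀ hβ0, mul_assoc, mul_assoc, inv_mul_cancel₀ hb20, mul_one] at this
    have hxx : β * b1 * x = β * a1 := by rw [hx1, mul_assoc, mul_inv_cancel_left₀ hb10]
    have hyy : β * b1 * y = α * a2 := by rw [hbb, hy1, mul_assoc, mul_inv_cancel_left₀ hb20]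
    have hpow : ∀ a ∈ A, ∃ n, a ∈ V ^ n := fun a ha => mem_pow_of_adjoin V h1V a (by rw [hVA]; exact ha)
    obtain ⟨i, hi⟩ := hpow _ (mul_mem hβ hb1)
    obtain ⟨j, hj⟩ := hpow _ (mul_mem hβ ha1)
    obtain ⟨l, hl⟩ := hpow _ (mul_mem hα ha2)
    refine ⟨i + j + l, β * b1, mul_ne_zero hβ0 hb10, hm (by omega) hi, ?_, ?_⟩
    · rw [hxx]; exact hm (by omega) hj
    · rw [hyy]; exact hm (by omega) hl
  haveI hVn : ∀ n, Module.Finite K (V ^ n : Submodule K Q) := fun n =>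
    Module.Finite.iff_fg.mpr ((Module.Finite.iff_fg.mp hVfin).pow n)
  let T : ℕ → ℕ := fun n => Module.finrank K (V ^ n : Submodule K Q)
  have hT1 : ∀ n, 1 ≤ T n := by
    intro n
    rw [Nat.one_le_iff_ne_zero]
    intro h
    have h0 : V ^ n = ⊥ := Submodule.finrank_eq_zero.mp h
    have h1 : (1 : Q) ∈ V ^ n := hm (Nat.zero_le n) (by
      change (1 : Q) ∈ V ^ 0
      rw [pow_zero]; exact Submodule.one_le.mp le_rfl)
    rw [h0] at h1
    exact one_ne_zero ((Submodule.mem_bot K).mp h1)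
  have hTm : Monotone T := fun i j hij => Submodule.finrank_mono (hm hij)
  obtain ⟨q, hq3, n0, hup⟩ := gk_bound T hT1 hGKA
  refine numeric T k0 C hT1 hTm (fun m n => ?_) q hq3 n0 hup
  obtain ⟨N, S, hr, hN, s, hsS, hs⟩ := hC m
  let B : Submodule K Q := (V ^ (n + k0)).comap (LinearMap.mulLeft K b)
  let g : B →ₗ[K] (V ^ (n + k0) : Submodule K Q) :=
    (LinearMap.mulLeft K b).restrict fun v hv => hv
  have hg : Function.Injective g := by
    intro u v h
    exact Subtype.ext (mul_left_cancel₀ hb0 (congrArg Subtype.val h))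
  haveI : Module.Finite K B := Module.Finite.of_injective g hg
  have hB : Module.finrank K B ≤ T (n + k0) := LinearMap.finrank_le_finrank_of_injective hg
  have hpw : ∀ c ∈ V ^ k0, ∀ u ∈ V ^ n, c * u ∈ V ^ (n + k0) := by
    intro c hc u hu
    rw [add_comm, pow_add]
    exact Submodule.mul_mem_mul hc hu
  obtain ⟨ρ, d, e1, e2, e3⟩ := main_step D' hDK x y hx hy E rfl hxK V h1V hns m n N S hr s hsS hs B
    (fun u hu => hpw b hb1 u hu)
    (fun u hu => by
      change b * (x * u) ∈ V ^ (n + k0)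
      rw [← mul_assoc]; exact hpw _ hb2 u hu)
    (fun u hu => by
      change b * (y * u) ∈ V ^ (n + k0)
      rw [← mul_assoc]; exact hpw _ hb3 u hu)
  exact ineq_arith _ N d _ ρ _ _ m n C e1 e2 e3 hB hN
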